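/- Let q₁ ≡ 7 (mod 8) and q₂ ≡ 3 (mod 8) be primes and r a prime with r ≡ 5 (mod 8), (q₁q₂/r) = 1 and (q₁/r) = 1. Then the 2-class group of K = Q(√(q₁q₂), √(2r·δ)) with δ ∈ {1, q₁, q₂} chosen so that δr ≡ 3 (mod 4), has rank exactly 2. -/

import Mathlib

open NumberField

/-- The subfield of ℝ generated over ℚ by a set of real numbers. -/
noncomputable def Qadj (S : Set ℝ) : IntermediateField ℚ ℝ := IntermediateField.adjoin ℚ S

/-- The 2-rank of a (finite) abelian group: log₂ of the number of elements of order
dividing 2. -/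
noncomputable def twoRank (G : Type*) [CommGroup G] : ℕ :=
  Nat.log 2 (Nat.card {x : G // x ^ 2 = 1})

section quad
variable {k L : Type*} [Field k] [Field L] [Algebra k L]

theorem quad_basis (h2 : Module.finrank k L = 2) (d : k) (hd : ¬ IsSquare d) (a : L)
    (ha : a ^ 2 = algebraMap k L d) : ∃ B : Module.Basis (Fin 2) k L, B 0 = 1 ∧ B 1 = a := by
  have hli : LinearIndependent k ![(1 : L), a] := by
    rw [LinearIndependent.pair_iff]
    intro s t hst
    have ht : t = 0 := by
      by_contra ht
      apply hd
      refine ⟨s / t, ?_⟩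
      apply (algebraMap k L).injective
      rw [← ha]
      have ht' : algebraMap k L t ≠ 0 := by simpa using ht
      have : a = - (algebraMap k L s / algebraMap k L t) := by
        rw [Algebra.smul_def, Algebra.smul_def] at hst
        field_simp
        linear_combination hst
      rw [this, map_mul, map_div₀]; ring
    subst ht
    simpa using hst
  have : Fintype.card (Fin 2) = Module.finrank k L := by simp [h2]
  refine ⟨basisOfLinearIndependentOfCardEqFinrank hli this, ?_, ?_⟩ <;> simp

theorem quad_repr (h2 : Module.finrank k L = 2) (d : k) (hd : ¬ IsSquare d) (a : L)
    (ha : a ^ 2 = algebraMap k L d) (y : L) :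
    ∃ u v : k, y = algebraMap k L u + algebraMap k L v * a := by
  obtain ⟨B, h0, h1⟩ := quad_basis h2 d hd a ha
  refine ⟨B.repr y 0, B.repr y 1, ?_⟩
  conv_lhs => rw [← B.sum_repr y]
  simp [Fin.sum_univ_two, h0, h1, Algebra.smul_def]

theorem quad_norm (h2 : Module.finrank k L = 2) (d : k) (hd : ¬ IsSquare d) (a : L)
    (ha : a ^ 2 = algebraMap k L d) (u v : k) :
    Algebra.norm k (algebraMap k L u + algebraMap k L v * a) = u ^ 2 - d * v ^ 2 := by
  obtain ⟨B, h0, h1⟩ := quad_basis h2 d hd a ha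
  rw [Algebra.norm_eq_matrix_det B, Matrix.det_fin_two]
  simp only [Algebra.leftMulMatrix_eq_repr_mul, h0, h1]
  have e0 : (algebraMap k L u + algebraMap k L v * a) * 1 = u • B 0 + v • B 1 := by
    simp [h0, h1, Algebra.smul_def]
  have e1 : (algebraMap k L u + algebraMap k L v * a) * a = (v * d) • B 0 + u • B 1 := by
    simp [h0, h1, Algebra.smul_def]
    linear_combination (algebraMap k L v) * ha
  rw [e0, e1]
  simp
  ring

theorem quad_hom (h2 : Module.finrank k L = 2) (d : k) (hd : ¬ IsSquare d) (a : L)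
    (ha : a ^ 2 = algebraMap k L d) {E : Type*} [Field E] [Algebra k E] (s : E)
    (hs : s ^ 2 = algebraMap k E d) : ∃ φ : L →ₐ[k] E, φ a = s := by
  obtain ⟨B, h0, h1⟩ := quad_basis h2 d hd a ha
  let f : L →ₗ[k] E := B.constr k ![1, s]
  have f0 : f 1 = 1 := by rw [← h0]; simp [f]
  have f1 : f a = s := by rw [← h1]; simp [f]
  have key : ∀ u v : k, f (algebraMap k L u + algebraMap k L v * a)
      = algebraMap k E u + algebraMap k E v * s := by
    intro u v
    have : algebraMap k L u + algebraMap k L v * a = u • 1 + v • a := by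
      simp [Algebra.smul_def]
    rw [this, map_add, map_smul, map_smul, f0, f1]
    simp [Algebra.smul_def]
  refine ⟨AlgHom.ofLinearMap f f0 ?_, ?_⟩
  · intro x y
    obtain ⟨u, v, rfl⟩ := quad_repr h2 d hd a ha x
    obtain ⟨u', v', rfl⟩ := quad_repr h2 d hd a ha y
    have : (algebraMap k L u + algebraMap k L v * a) * (algebraMap k L u' + algebraMap k L v' * a)
      = algebraMap k L (u * u' + d * (v * v')) + algebraMap k L (u * v' + v * u') * a := by
      simp only [map_add, map_mul]
      linear_combination (algebraMap k L v) * (algebraMap k L v') * ha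
    rw [this, key, key, key]
    simp only [map_add, map_mul]
    linear_combination -(algebraMap k E v) * (algebraMap k E v') * hs
  · simpa using f1

theorem quad_sq [CharZero k] (h2 : Module.finrank k L = 2) (d : k) (hd : ¬ IsSquare d) (a : L)
    (ha : a ^ 2 = algebraMap k L d) (y : L) (hy : y ≠ 0) (c : k) (hc : Algebra.norm k y = c ^ 2) :
    ∃ (x : k) (f : L), x ≠ 0 ∧ f ≠ 0 ∧ y = algebraMap k L x * f ^ 2 := by
  obtain ⟨u, v, huv⟩ := quad_repr h2 d hd a ha y
  have hn : u ^ 2 - d * v ^ 2 = c ^ 2 := by rw [← hc, huv, quad_norm h2 d hd a ha]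
  by_cases h : y + algebraMap k L c = 0
  · refine ⟨-c, 1, ?_, one_ne_zero, ?_⟩
    · rintro h0
      apply hy
      have : c = 0 := by simpa using h0
      simpa [this] using h
    · rw [map_neg]; linear_combination h
  · have e : (y + algebraMap k L c) ^ 2 = y * algebraMap k L (2 * (u + c)) := by
      have hn' := congrArg (algebraMap k L) hn
      simp only [map_add, map_mul, map_sub, map_pow] at hn' ⊢
      rw [huv]
      have h2 : (algebraMap k L) 2 = 2 := map_ofNat _ 2
      rw [h2]
      linear_combination (algebraMap k L v) ^ 2 * ha - hn'
    have hx : 2 * (u + c) ≠ 0 := by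
      intro h0
      rw [h0] at e
      simp at e
      exact h e
    have hx' : algebraMap k L (2 * (u + c)) ≠ 0 := by
      intro h'; exact hx ((map_eq_zero _).1 h')
    refine ⟨2 * (u + c), (y + algebraMap k L c) / algebraMap k L (2 * (u + c)), hx,
      div_ne_zero h hx', ?_⟩
    rw [div_pow, e]
    field_simp
end quad

open UniqueFactorizationMonoid in
theorem count_map_eq {A B : Type*} [CommRing A] [IsDedekindDomain A] [CommRing B]
    [IsDedekindDomain B] [Algebra A B] [FaithfulSMul A B]
    (P : Ideal B) (hP : P.IsPrime) (p : Ideal A) (hp : p = P.comap (algebraMap A B)) (hp0 : p ≠ ⊥)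
    (hun : ¬ P ^ 2 ∣ p.map (algebraMap A B)) (I : Ideal A) (hI : I ≠ ⊥) :
    Multiset.count P (normalizedFactors (I.map (algebraMap A B))) =
      Multiset.count p (normalizedFactors I) := by
  have inj := FaithfulSMul.algebraMap_injective A B
  have hpp : p.IsPrime := by rw [hp]; exact Ideal.IsPrime.comap _
  have hprime : Prime p := Ideal.prime_of_isPrime hp0 hpp
  have hmp0 : p.map (algebraMap A B) ≠ ⊥ := (Ideal.map_eq_bot_iff_of_injective inj).not.mpr hp0
  have hP0 : P ≠ ⊥ := by
    rintro rfl
    apply hp0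
    rw [hp, Ideal.comap_bot_of_injective _ inj]
  have hPprime : Prime P := Ideal.prime_of_isPrime hP0 hP
  obtain ⟨J, hJ, hndvd⟩ : ∃ J, I = p ^ (Multiset.count p (normalizedFactors I)) * J ∧ ¬ p ∣ J := by
    have hfin : FiniteMultiplicity p I := FiniteMultiplicity.of_prime_left hprime hI
    obtain ⟨J, hJ, h⟩ := hfin.exists_eq_pow_mul_and_not_dvd
    refine ⟨J, ?_, h⟩
    have := emultiplicity_eq_count_normalizedFactors hprime.irreducible hI
    rw [normalize_eq] at this
    rw [multiplicity_eq_of_emultiplicity_eq_some this] at hJ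
    exact hJ
  have hJ0 : J ≠ ⊥ := by
    rintro rfl
    exact hI (by simpa using hJ)
  have hmJ0 : J.map (algebraMap A B) ≠ ⊥ := (Ideal.map_eq_bot_iff_of_injective inj).not.mpr hJ0
  generalize Multiset.count p (normalizedFactors I) = k at *
  have c1 : Multiset.count P (normalizedFactors (p.map (algebraMap A B))) = 1 := by
    have h1 : 1 ≤ Multiset.count P (normalizedFactors (p.map (algebraMap A B))) := by
      rw [Multiset.one_le_count_iff_mem, Ideal.mem_normalizedFactors_iff hmp0]
      exact ⟨hP, by rw [Ideal.map_le_iff_le_comap, hp]⟩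
    have h2 : ¬ 2 ≤ Multiset.count P (normalizedFactors (p.map (algebraMap A B))) := by
      intro h
      apply hun
      rw [dvd_iff_normalizedFactors_le_normalizedFactors (pow_ne_zero _ hP0) hmp0,
        normalizedFactors_pow, normalizedFactors_irreducible hPprime.irreducible, normalize_eq,
        Multiset.nsmul_singleton, ← Multiset.le_count_iff_replicate_le]
      exact h
    omega
  have c2 : Multiset.count P (normalizedFactors (J.map (algebraMap A B))) = 0 := by
    rw [Multiset.count_eq_zero, Ideal.mem_normalizedFactors_iff hmJ0]
    rintro ⟨-, h⟩
    apply hndvd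
    rw [Ideal.dvd_iff_le, hp]
    rwa [Ideal.map_le_iff_le_comap] at h
  rw [hJ, Ideal.map_mul, Ideal.map_pow, normalizedFactors_mul (pow_ne_zero _ hmp0) hmJ0,
    Multiset.count_add, normalizedFactors_pow, Multiset.count_nsmul, c1, c2]
  simp

open UniqueFactorizationMonoid in
theorem count_sq_even {B : Type*} [CommRing B] [IsDedekindDomain B] (J P : Ideal B) :
    Even (Multiset.count P (normalizedFactors (J ^ 2))) := by
  rw [normalizedFactors_pow, Multiset.count_nsmul]
  simp

open Polynomial in
theorem deriv_mem_different (F K : Type*) [Field F] [NumberField F] [Field K] [NumberField K]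
    [Algebra F K] (x : 𝓞 K) (f : (𝓞 F)[X]) (hf : aeval x f = 0)
    (hx : Algebra.adjoin F {(x : K)} = ⊤) :
    aeval x (derivative f) ∈ differentIdeal (𝓞 F) (𝓞 K) := by
  have hInt : IsIntegral (𝓞 F) x := Algebra.IsIntegral.isIntegral x
  obtain ⟨g, rfl⟩ := minpoly.isIntegrallyClosed_dvd hInt hf
  have := aeval_derivative_mem_differentIdeal (𝓞 F) F K x hx
  rw [derivative_mul, map_add, map_mul, map_mul, minpoly.aeval, zero_mul, add_zero]
  exact Ideal.mul_mem_right _ _ this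

open Polynomial in
theorem deriv_mem_different_int (F : Type*) [Field F] [NumberField F]
    (x : 𝓞 F) (f : ℤ[X]) (hf : aeval x f = 0)
    (hx : Algebra.adjoin ℚ {(x : F)} = ⊤) :
    aeval x (derivative f) ∈ differentIdeal ℤ (𝓞 F) := by
  have hInt : IsIntegral ℤ x := Algebra.IsIntegral.isIntegral x
  obtain ⟨g, rfl⟩ := minpoly.isIntegrallyClosed_dvd hInt hf
  have := aeval_derivative_mem_differentIdeal ℤ ℚ F x hx
  rw [derivative_mul, map_add, map_mul, map_mul, minpoly.aeval, zero_mul, add_zero]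
  exact Ideal.mul_mem_right _ _ this

open Polynomial in
theorem not_sq_dvd (F K : Type*) [Field F] [NumberField F] [Field K] [NumberField K]
    [Algebra F K] (x : 𝓞 K) (f : (𝓞 F)[X]) (hf : aeval x f = 0)
    (hx : Algebra.adjoin F {(x : K)} = ⊤) (P : Ideal (𝓞 K))
    (hP : aeval x (derivative f) ∉ P) (p : Ideal (𝓞 F)) (hp : p.IsPrime) (hp0 : p ≠ ⊥) :
    ¬ P ^ 2 ∣ p.map (algebraMap (𝓞 F) (𝓞 K)) := by
  intro h
  have : p.IsMaximal := hp.isMaximal hp0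
  have h1 := pow_sub_one_dvd_differentIdeal (𝓞 F) P 2 hp0 h
  rw [show 2 - 1 = 1 from rfl, pow_one, Ideal.dvd_iff_le] at h1
  exact hP (h1 (deriv_mem_different F K x f hf hx))

open Polynomial in
theorem not_sq_dvd_int (F : Type*) [Field F] [NumberField F]
    (x : 𝓞 F) (f : ℤ[X]) (hf : aeval x f = 0)
    (hx : Algebra.adjoin ℚ {(x : F)} = ⊤) (P : Ideal (𝓞 F))
    (hP : aeval x (derivative f) ∉ P) (p : Ideal ℤ) (hp : p.IsPrime) (hp0 : p ≠ ⊥) :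
    ¬ P ^ 2 ∣ p.map (algebraMap ℤ (𝓞 F)) := by
  intro h
  have : p.IsMaximal := hp.isMaximal hp0
  have h1 := pow_sub_one_dvd_differentIdeal ℤ P 2 hp0 h
  rw [show 2 - 1 = 1 from rfl, pow_one, Ideal.dvd_iff_le] at h1
  exact hP (h1 (deriv_mem_different_int F x f hf hx))

/-- `β` is, up to squares, an integer generating the square of an ideal. -/
def SelP (K : Type*) [Field K] [NumberField K] (β : K) : Prop :=
  ∃ (n θ : 𝓞 K) (J : Ideal (𝓞 K)), n ≠ 0 ∧ θ ≠ 0 ∧ Ideal.span {θ} = J ^ 2 ∧ β * (algebraMap (𝓞 K) K n) ^ 2 = algebraMap (𝓞 K) K θ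

section sel
variable {K : Type*} [Field K] [NumberField K]

theorem coe_ne_zero' {x : 𝓞 K} (h : x ≠ 0) : algebraMap (𝓞 K) K x ≠ 0 := by
  simpa using h

theorem exists_den (y : K) : ∃ m l : 𝓞 K, l ≠ 0 ∧ y * algebraMap (𝓞 K) K l = algebraMap (𝓞 K) K m := by
  obtain ⟨m, l, hl, h⟩ := IsFractionRing.div_surjective (A := 𝓞 K) y
  have hl' : l ≠ 0 := nonZeroDivisors.ne_zero hl
  refine ⟨m, l, hl', ?_⟩
  rw [← h]
  have := coe_ne_zero' hl'
  field_simp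

theorem SelP.ne_zero {β : K} (h : SelP K β) : β ≠ 0 := by
  obtain ⟨n, θ, J, hn, hθ, -, h⟩ := h
  rintro rfl
  apply coe_ne_zero' hθ
  rw [← h]; simp

theorem SelP.mul {β γ : K} (h : SelP K β) (h' : SelP K γ) : SelP K (β * γ) := by
  obtain ⟨n, θ, J, hn, hθ, hJ, h⟩ := h
  obtain ⟨n', θ', J', hn', hθ', hJ', h'⟩ := h'
  refine ⟨n * n', θ * θ', J * J', mul_ne_zero hn hn', mul_ne_zero hθ hθ', ?_, ?_⟩
  · rw [← Ideal.span_singleton_mul_span_singleton, hJ, hJ', mul_pow]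
  · simp only [map_mul]
    rw [← h, ← h']; ring

theorem SelP.sq {k : K} (hk : k ≠ 0) : SelP K (k ^ 2) := by
  obtain ⟨m, l, hl, h⟩ := exists_den k
  refine ⟨l, m ^ 2, Ideal.span {m}, hl, ?_, ?_, ?_⟩
  · apply pow_ne_zero
    rintro rfl
    have := coe_ne_zero' hl
    simp_all
  · rw [Ideal.span_singleton_pow]
  · rw [map_pow, ← h]; ring

theorem SelP.inv {β : K} (h : SelP K β) : SelP K β⁻¹ := by
  have h0 := h.ne_zero
  have := h.mul (SelP.sq (inv_ne_zero h0))
  convert this using 1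
  field_simp

theorem SelP.of_mul_sq {β k : K} (hk : k ≠ 0) (h : SelP K (β * k ^ 2)) : SelP K β := by
  have := h.mul (SelP.sq (inv_ne_zero hk))
  convert this using 1
  field_simp

open UniqueFactorizationMonoid in
theorem SelP.even_count {θ : 𝓞 K} (h : SelP K (algebraMap (𝓞 K) K θ)) (P : Ideal (𝓞 K)) :
    Even (Multiset.count P (normalizedFactors (Ideal.span {θ}))) := by
  have h0 := h.ne_zero
  obtain ⟨n, η, J, hn, hη, hJ, h⟩ := h
  have e : θ * n ^ 2 = η := by
    apply RingOfIntegers.ext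
    simpa using h
  have hθ : θ ≠ 0 := by rintro rfl; simp at h0
  have h1 : Ideal.span {θ} * Ideal.span {n} ^ 2 = J ^ 2 := by
    rw [← hJ, ← e, Ideal.span_singleton_pow, Ideal.span_singleton_mul_span_singleton]
  have c1 := count_sq_even J P
  have c2 := count_sq_even (Ideal.span {n}) P
  rw [← h1, normalizedFactors_mul (by simpa using hθ) (pow_ne_zero _ (by simpa using hn)),
    Multiset.count_add] at c1
  rw [Nat.even_add] at c1
  exact c1.2 c2
end sel

/-- relative norm -/
theorem SelP.norm {F K : Type*} [Field F] [NumberField F] [Field K] [NumberField K] [Algebra F K]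
    {β : K} (h : SelP K β) : SelP F (Algebra.norm F β) := by
  obtain ⟨n, θ, J, hn, hθ, hJ, h⟩ := h
  refine ⟨Algebra.intNorm (𝓞 F) (𝓞 K) n, Algebra.intNorm (𝓞 F) (𝓞 K) θ, Ideal.relNorm (𝓞 F) J,
    ?_, ?_, ?_, ?_⟩
  · simpa using hn
  · simpa using hθ
  · rw [← Ideal.relNorm_singleton, hJ, map_pow]
  · have := congrArg (Algebra.norm F) h
    rw [map_mul, map_pow] at this
    rw [Algebra.algebraMap_intNorm (K := F) (L := K), Algebra.algebraMap_intNorm (K := F) (L := K)]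
    exact this

theorem padic_norm_sq_ne {p : ℕ} [Fact p.Prime] (D X Z : ℚ_[p]) (hD : ‖D‖ = (p : ℝ)⁻¹)
    (hX : X ≠ 0) (hZ : Z ≠ 0) : ‖X ^ 2‖ ≠ ‖D * Z ^ 2‖ := by
  intro h
  have hp : (1 : ℝ) < p := by exact_mod_cast (Fact.out : p.Prime).one_lt
  have hn := Padic.norm_eq_zpow_neg_valuation hX
  have hm := Padic.norm_eq_zpow_neg_valuation hZ
  rw [norm_pow, norm_mul, norm_pow, hD, hn, hm] at h
  rw [← zpow_natCast, ← zpow_natCast, ← zpow_mul, ← zpow_mul, ← zpow_neg_one,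
    ← zpow_add₀ (by positivity)] at h
  have := zpow_right_injective₀ (by positivity) hp.ne' h
  push_cast at this
  omega

theorem pad1 {p : ℕ} [Fact p.Prime] (D X Z : ℚ_[p]) (hD : ‖D‖ = (p : ℝ)⁻¹) (s : ℤ)
    (hs : ¬ (p : ℤ) ∣ s) (h : X ^ 2 - D * Z ^ 2 = s) : IsSquare (s : ZMod p) := by
  have hp : (1 : ℝ) < p := by exact_mod_cast (Fact.out : p.Prime).one_lt
  have hs1 : ‖(s : ℚ_[p])‖ = 1 := by
    rcases lt_or_eq_of_le (Padic.norm_int_le_one (p := p) s) with h1 | h1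
    · exact absurd (Padic.norm_intCast_lt_one_iff.1 h1) hs
    · exact h1
  have hkey : ‖X‖ = 1 ∧ ‖D * Z ^ 2‖ < 1 := by
    by_cases hX : X = 0
    · exfalso
      have hZ : Z ≠ 0 := by
        rintro rfl
        subst hX
        rw [← h] at hs1
        simp at hs1
      apply padic_norm_sq_ne D 1 Z hD one_ne_zero hZ
      rw [← norm_neg (D * Z ^ 2)]
      subst hX
      rw [show -(D * Z ^ 2) = s by rw [← h]; ring, hs1]; simp
    by_cases hZ : Z = 0
    · subst hZ
      simp only [ne_eq, OfNat.ofNat_ne_zero, not_false_eq_true, zero_pow, mul_zero, sub_zero] at h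
      rw [← h, norm_pow] at hs1
      refine ⟨?_, by simp⟩
      exact (pow_eq_one_iff_of_nonneg (norm_nonneg _) two_ne_zero).1 hs1
    have hne := padic_norm_sq_ne D X Z hD hX hZ
    have hmax : ‖X ^ 2 - D * Z ^ 2‖ = max ‖X ^ 2‖ ‖D * Z ^ 2‖ := by
      rw [sub_eq_add_neg, Padic.add_eq_max_of_ne (by rwa [norm_neg]), norm_neg]
    rw [h, hs1] at hmax
    rcases lt_or_gt_of_ne hne with hlt | hlt
    · exfalso
      rw [max_eq_right hlt.le] at hmax
      apply padic_norm_sq_ne D 1 Z hD one_ne_zero hZ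
      rw [← hmax]; simp
    · rw [max_eq_left hlt.le] at hmax
      refine ⟨?_, by rwa [hmax]⟩
      rw [norm_pow] at hmax
      exact (pow_eq_one_iff_of_nonneg (norm_nonneg _) two_ne_zero).1 hmax.symm
  obtain ⟨h1, h2⟩ := hkey
  let x : ℤ_[p] := ⟨X, h1.le⟩
  have hx : ‖x ^ 2 - (s : ℤ_[p])‖ < 1 := by
    rw [PadicInt.norm_def]
    push_cast
    rw [show ((x : ℚ_[p]) ^ 2 - (s : ℚ_[p])) = D * Z ^ 2 by rw [← h]; simp [x]]
    exact h2
  have hm : PadicInt.toZMod (x ^ 2 - (s : ℤ_[p])) = 0 := by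
    rw [← RingHom.mem_ker, PadicInt.ker_toZMod, PadicInt.maximalIdeal_eq_span_p,
      Ideal.mem_span_singleton, ← PadicInt.norm_lt_one_iff_dvd]
    exact hx
  refine ⟨PadicInt.toZMod x, ?_⟩
  rw [map_sub, map_pow, map_intCast, sub_eq_zero] at hm
  rw [← hm, sq]

theorem pad_sqrt {p : ℕ} [Fact p.Prime] (hp2 : p ≠ 2) (s : ℤ) (hs : ¬ (p : ℤ) ∣ s)
    (h : IsSquare (s : ZMod p)) : ∃ t : ℚ_[p], t ^ 2 = s := by
  obtain ⟨t, ht⟩ := h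
  obtain ⟨t, rfl⟩ := ZMod.intCast_surjective t
  have hdvd : (p : ℤ) ∣ t ^ 2 - s := by
    rw [← ZMod.intCast_zmod_eq_zero_iff_dvd]
    push_cast
    rw [ht]; ring
  have hpp : Prime (p : ℤ) := Nat.prime_iff_prime_int.1 Fact.out
  have hnd : ¬ (p : ℤ) ∣ 2 * t := by
    intro hd
    rcases hpp.dvd_or_dvd hd with h2 | h2
    · have h3 : p ∣ 2 := by exact_mod_cast h2
      exact hp2 ((Nat.prime_dvd_prime_iff_eq Fact.out Nat.prime_two).1 h3)
    · apply hs
      have : s = t * t - (t ^ 2 - s) := by ring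
      rw [this]
      exact dvd_sub (h2.mul_right t) hdvd
  have n1 : ‖((2 * t : ℤ) : ℤ_[p])‖ = 1 := by
    rcases lt_or_eq_of_le (PadicInt.norm_le_one ((2 * t : ℤ) : ℤ_[p])) with h1 | h1
    · exact absurd ((PadicInt.norm_int_lt_one_iff_dvd _).1 h1) hnd
    · exact h1
  have n2 : ‖((t ^ 2 - s : ℤ) : ℤ_[p])‖ < 1 := (PadicInt.norm_int_lt_one_iff_dvd _).2 hdvd
  obtain ⟨z, hz, -⟩ := hensels_lemma (p := p) (R := ℤ)
    (F := (Polynomial.X ^ 2 - Polynomial.C s : Polynomial ℤ)) (a := (t : ℤ_[p])) (by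
      simp only [map_sub, map_pow, Polynomial.aeval_X, Polynomial.derivative_X_pow,
        Polynomial.derivative_C, sub_zero, Polynomial.aeval_C, map_mul]
      push_cast at n1 n2
      simp only [algebraMap_int_eq, eq_intCast]
      norm_num
      push_cast at n1 n2
      rw [← norm_mul, n1]
      simpa using n2)
  refine ⟨z, ?_⟩
  simp only [map_sub, map_pow, Polynomial.aeval_X, Polynomial.aeval_C, algebraMap_int_eq,
    eq_intCast, sub_eq_zero] at hz
  have := congrArg (fun x : ℤ_[p] => (x : ℚ_[p])) hz
  simpa using this

/-- Products of powers of four given numbers and a square. -/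
def Msub (t₁ t₂ t₃ t₄ : ℕ) : Submonoid ℕ where
  carrier := {n | ∃ i j k l c : ℕ, n = t₁ ^ i * t₂ ^ j * t₃ ^ k * t₄ ^ l * c ^ 2}
  one_mem' := ⟨0, 0, 0, 0, 1, by simp⟩
  mul_mem' := by
    rintro _ _ ⟨i, j, k, l, c, rfl⟩ ⟨i', j', k', l', c', rfl⟩
    exact ⟨i + i', j + j', k + k', l + l', c * c', by ring⟩

open UniqueFactorizationMonoid in
theorem absNorm_mem_Msub {R : Type*} [CommRing R] [IsDedekindDomain R] [Module.Free ℤ R]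
    [Module.Finite ℤ R] (t₁ t₂ t₃ t₄ : ℕ) (h₁ : t₁.Prime ∨ t₁ = 1)
    (h₂ : t₂.Prime ∨ t₂ = 1) (h₃ : t₃.Prime ∨ t₃ = 1) (h₄ : t₄.Prime ∨ t₄ = 1)
    (I : Ideal R) (hI : I ≠ ⊥)
    (h : ∀ P : Ideal R, P.IsPrime → P ≠ ⊥ → (t₁ : R) ∉ P → (t₂ : R) ∉ P → (t₃ : R) ∉ P →
      (t₄ : R) ∉ P → Even (Multiset.count P (normalizedFactors I))) :
    Ideal.absNorm I ∈ Msub t₁ t₂ t₃ t₄ := by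
  classical
  rw [← Ideal.prod_normalizedFactors_eq_self hI, Finset.prod_multiset_count, map_prod]
  apply Submonoid.prod_mem
  intro P hP
  rw [Multiset.mem_toFinset] at hP
  have hP0 : P ≠ ⊥ := ne_zero_of_mem_normalizedFactors hP
  have hPp : P.IsPrime := ((Ideal.mem_normalizedFactors_iff hI).1 hP).1
  rw [map_pow]
  have key : ∀ t : ℕ, (t.Prime ∨ t = 1) → (t : R) ∈ P → ∃ n, Ideal.absNorm P = t ^ n := by
    intro t ht htP
    rcases ht with ht | rfl
    · have hl : P.LiesOver (Ideal.span {(t : ℤ)}) := by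
        rw [Ideal.liesOver_iff]
        have hm : (Ideal.span {(t : ℤ)}).IsMaximal := by
          have : Prime (t : ℤ) := Nat.prime_iff_prime_int.1 ht
          exact ((Ideal.span_singleton_prime this.ne_zero).2 this).isMaximal
            (by simpa using this.ne_zero)
        apply hm.eq_of_le
        · exact (Ideal.IsPrime.under ℤ P).ne_top
        · rw [Ideal.span_singleton_le_iff_mem, Ideal.mem_comap]
          simpa using htP
      have := Ideal.absNorm_eq_pow_inertiaDeg P (p := (t : ℤ)) (Nat.prime_iff_prime_int.1 ht)
      exact ⟨_, by simpa using this⟩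
    · exfalso
      apply hPp.ne_top
      rw [Ideal.eq_top_iff_one]
      simpa using htP
  by_cases a₁ : (t₁ : R) ∈ P
  · obtain ⟨n, hn⟩ := key t₁ h₁ a₁
    rw [hn]
    refine Submonoid.pow_mem (Msub t₁ t₂ t₃ t₄) ?_ _
    exact ⟨n, 0, 0, 0, 1, by simp⟩
  by_cases a₂ : (t₂ : R) ∈ P
  · obtain ⟨n, hn⟩ := key t₂ h₂ a₂
    rw [hn]
    refine Submonoid.pow_mem (Msub t₁ t₂ t₃ t₄) ?_ _
    exact ⟨0, n, 0, 0, 1, by simp⟩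
  by_cases a₃ : (t₃ : R) ∈ P
  · obtain ⟨n, hn⟩ := key t₃ h₃ a₃
    rw [hn]
    refine Submonoid.pow_mem (Msub t₁ t₂ t₃ t₄) ?_ _
    exact ⟨0, 0, n, 0, 1, by simp⟩
  by_cases a₄ : (t₄ : R) ∈ P
  · obtain ⟨n, hn⟩ := key t₄ h₄ a₄
    rw [hn]
    refine Submonoid.pow_mem (Msub t₁ t₂ t₃ t₄) ?_ _
    exact ⟨0, 0, 0, n, 1, by simp⟩
  obtain ⟨m, hm⟩ := h P hPp hP0 a₁ a₂ a₃ a₄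
  exact ⟨0, 0, 0, 0, Ideal.absNorm P ^ m, by
    rw [show Multiset.count P (normalizedFactors I) = m * 2 by rw [mul_two]; convert hm, pow_mul]; simp⟩

/-- arithmetic hypotheses -/
structure Hyp (q₁ q₂ r δ δ' : ℕ) : Prop where
  hq₁ : q₁.Prime
  hq₂ : q₂.Prime
  hr : r.Prime
  hne : q₁ ≠ q₂
  hr1 : r ≠ q₁
  hr2 : r ≠ q₂
  hq₁8 : q₁ % 8 = 7
  hq₂8 : q₂ % 8 = 3
  hr8 : r % 8 = 5
  s1 : IsSquare (q₁ : ZMod r)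
  s2 : IsSquare (q₂ : ZMod r)
  hδ : (δ = q₁ ∧ δ' = q₂) ∨ (δ = q₂ ∧ δ' = q₁)

structure FD (q₁ q₂ r δ : ℕ) (F K : Type*) [Field F] [NumberField F] [Field K] [NumberField K]
    [Algebra F K] (a : F) (b : K) : Prop where
  finF : Module.finrank ℚ F = 2
  finK : Module.finrank F K = 2
  ha : a ^ 2 = algebraMap ℚ F (q₁ * q₂)
  hb : b ^ 2 = algebraMap F K (2 * r * δ)
  nsF : ¬ IsSquare ((q₁ * q₂ : ℚ))
  nsK : ¬ IsSquare ((2 * r * δ : F))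

theorem norm_natCast_eq_one {p : ℕ} [Fact p.Prime] (n : ℕ) (h : ¬ p ∣ n) : ‖(n : ℚ_[p])‖ = 1 := by
  rcases lt_or_eq_of_le (Padic.norm_int_le_one (p := p) n) with h1 | h1
  · exact absurd (by exact_mod_cast (Padic.norm_intCast_lt_one_iff.1 h1)) h
  · exact_mod_cast h1

theorem norm_pq {p : ℕ} [Fact p.Prime] (n : ℕ) (h : ¬ p ∣ n) :
    ‖(p * n : ℚ_[p])‖ = (p : ℝ)⁻¹ := by
  rw [norm_mul, norm_natCast_eq_one n h, Padic.norm_p, mul_one]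

/-- residue condition for rational norms -/
theorem norm_res {q q' : ℕ} (hq : q.Prime) (h : ¬ q ∣ q') (u v c : ℚ) (hc : c ≠ 0) (s : ℤ)
    (hs : ¬ (q : ℤ) ∣ s) (e : u ^ 2 - (q * q') * v ^ 2 = s * c ^ 2) : IsSquare (s : ZMod q) := by
  have : Fact q.Prime := ⟨hq⟩
  apply pad1 (p := q) (q * q' : ℚ_[q]) ((u / c : ℚ) : ℚ_[q]) ((v / c : ℚ) : ℚ_[q])
    (norm_pq _ h) s hs
  have : (u / c) ^ 2 - (q * q') * (v / c) ^ 2 = s := by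
    field_simp
    linear_combination e
  exact_mod_cast congrArg (fun x : ℚ => (x : ℚ_[q])) this

section
variable {q₁ q₂ r δ δ' : ℕ}

theorem Hyp.q1_ndvd (H : Hyp q₁ q₂ r δ δ') : ¬ q₁ ∣ q₂ := fun h =>
  H.hne ((Nat.prime_dvd_prime_iff_eq H.hq₁ H.hq₂).1 h)
theorem Hyp.q2_ndvd (H : Hyp q₁ q₂ r δ δ') : ¬ q₂ ∣ q₁ := fun h =>
  H.hne ((Nat.prime_dvd_prime_iff_eq H.hq₂ H.hq₁).1 h).symm

theorem Hyp.neg_one_q1 (H : Hyp q₁ q₂ r δ δ') : ¬ IsSquare (-1 : ZMod q₁) := by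
  have : Fact q₁.Prime := ⟨H.hq₁⟩
  rw [ZMod.exists_sq_eq_neg_one_iff]
  have := H.hq₁8
  omega

theorem Hyp.two_q1 (H : Hyp q₁ q₂ r δ δ') : IsSquare (2 : ZMod q₁) := by
  have : Fact q₁.Prime := ⟨H.hq₁⟩
  have := H.hq₁8
  rw [ZMod.exists_sq_eq_two_iff (by omega)]
  omega

theorem Hyp.two_q2 (H : Hyp q₁ q₂ r δ δ') : ¬ IsSquare (2 : ZMod q₂) := by
  have : Fact q₂.Prime := ⟨H.hq₂⟩
  have := H.hq₂8
  rw [ZMod.exists_sq_eq_two_iff (by omega)]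
  omega

theorem Hyp.two_r (H : Hyp q₁ q₂ r δ δ') : ¬ IsSquare (2 : ZMod r) := by
  have : Fact r.Prime := ⟨H.hr⟩
  have := H.hr8
  rw [ZMod.exists_sq_eq_two_iff (by omega)]
  omega

theorem Hyp.neg_one_r (H : Hyp q₁ q₂ r δ δ') : IsSquare (-1 : ZMod r) := by
  have : Fact r.Prime := ⟨H.hr⟩
  have := H.hr8
  rw [ZMod.exists_sq_eq_neg_one_iff]
  omega

theorem Hyp.r_q1 (H : Hyp q₁ q₂ r δ δ') : IsSquare (r : ZMod q₁) := by
  have : Fact r.Prime := ⟨H.hr⟩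
  have : Fact q₁.Prime := ⟨H.hq₁⟩
  have := H.hr8
  have := H.hq₁8
  exact (ZMod.exists_sq_eq_prime_iff_of_mod_four_eq_one (by omega) (by omega)).1 H.s1

theorem Hyp.r_q2 (H : Hyp q₁ q₂ r δ δ') : IsSquare (r : ZMod q₂) := by
  have : Fact r.Prime := ⟨H.hr⟩
  have : Fact q₂.Prime := ⟨H.hq₂⟩
  have := H.hr8
  have := H.hq₂8
  exact (ZMod.exists_sq_eq_prime_iff_of_mod_four_eq_one (by omega) (by omega)).1 H.s2
end

open UniqueFactorizationMonoid in
theorem even_descend {A B : Type*} [CommRing A] [IsDedekindDomain A] [CommRing B]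
    [IsDedekindDomain B] [Algebra A B] [FaithfulSMul A B] [Algebra.IsIntegral A B]
    (z : A) (hz : z ≠ 0) (p : Ideal A) (hp : p.IsPrime) (hp0 : p ≠ ⊥)
    (h : ∀ P : Ideal B, P.IsPrime → P.comap (algebraMap A B) = p →
      ¬ P ^ 2 ∣ p.map (algebraMap A B) ∧
        Even (Multiset.count P (normalizedFactors (Ideal.span {algebraMap A B z})))) :
    Even (Multiset.count p (normalizedFactors (Ideal.span {z}))) := by
  have : p.IsMaximal := hp.isMaximal hp0
  obtain ⟨P, hP, hPp⟩ := Ideal.exists_maximal_ideal_liesOver_of_isIntegral (S := B) p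
  obtain ⟨h1, h2⟩ := h P hP.isPrime (hPp.over).symm
  rw [← Set.image_singleton, ← Ideal.map_span] at h2
  rwa [count_map_eq P hP.isPrime p hPp.over hp0 h1 _ (by simpa using hz)] at h2

section
variable {q₁ q₂ r δ δ' : ℕ} {F K : Type*} [Field F] [NumberField F] [Field K] [NumberField K]
    [Algebra F K] {a : F} {b : K}

theorem ramF (H : Hyp q₁ q₂ r δ δ') (D : FD q₁ q₂ r δ F K a b) (P : Ideal (𝓞 F))
    (hP : P.IsPrime) (h1 : (q₁ : 𝓞 F) ∉ P) (h2 : (q₂ : 𝓞 F) ∉ P) (p : Ideal ℤ)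
    (hp : p.IsPrime) (hp0 : p ≠ ⊥) : ¬ P ^ 2 ∣ p.map (algebraMap ℤ (𝓞 F)) := by
  obtain ⟨m, hm⟩ : ∃ m : ℤ, (q₁ * q₂ : ℤ) = 1 + 4 * m := by
    refine ⟨(q₁ * q₂ - 1) / 4, ?_⟩
    have : ((q₁ * q₂ : ℕ) : ℤ) % 4 = 1 := by
      norm_cast
      have := H.hq₁8
      have := H.hq₂8
      have e1 : q₁ % 4 = 3 := by omega
      have e2 : q₂ % 4 = 3 := by omega
      simp [Nat.mul_mod, e1, e2]
    push_cast at this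
    omega
  have ha : a ^ 2 = 1 + 4 * (m : F) := by
    rw [D.ha]
    have := congrArg (fun x : ℤ => (x : F)) hm
    push_cast at this
    simpa using this
  have e : ((1 + a) / 2) ^ 2 - (1 + a) / 2 - (m : F) = 0 := by
    field_simp
    linear_combination ha
  have hInt : IsIntegral ℤ ((1 + a) / 2) := by
    refine ⟨Polynomial.X ^ 2 - Polynomial.X - Polynomial.C m, ?_, ?_⟩
    · monicity!
    · simp only [Polynomial.eval₂_sub, Polynomial.eval₂_pow, Polynomial.eval₂_X, Polynomial.eval₂_C]
      simpa using e
  set x : 𝓞 F := ⟨(1 + a) / 2, hInt⟩ with hx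
  have hxe : x ^ 2 - x - (m : 𝓞 F) = 0 := by
    apply RingOfIntegers.coe_injective
    have : algebraMap (𝓞 F) F x = (1 + a) / 2 := rfl
    simpa [this] using e
  refine not_sq_dvd_int F x (Polynomial.X ^ 2 - Polynomial.X - Polynomial.C m) ?_ ?_ P ?_ p hp hp0
  · simpa using hxe
  · rw [eq_top_iff]
    intro y _
    obtain ⟨u, v, rfl⟩ := quad_repr D.finF _ D.nsF a D.ha y
    have hxm : ((1 + a) / 2) ∈ Algebra.adjoin ℚ {(x : F)} := Algebra.subset_adjoin rfl
    have : a = algebraMap ℚ F 2 * ((1 + a) / 2) - algebraMap ℚ F 1 := by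
      simp; field_simp; ring
    rw [this]
    exact add_mem (Subalgebra.algebraMap_mem _ _) (mul_mem (Subalgebra.algebraMap_mem _ _)
      (sub_mem (mul_mem (Subalgebra.algebraMap_mem _ _) hxm) (Subalgebra.algebraMap_mem _ _)))
  · simp only [Polynomial.derivative_sub, Polynomial.derivative_X_pow, Polynomial.derivative_X,
      Polynomial.derivative_C]
    simp
    rw [show (Polynomial.aeval x) (2 : Polynomial ℤ) = (2 : 𝓞 F) from map_ofNat _ 2]
    intro h
    have : (2 * x - 1) ^ 2 = (q₁ : 𝓞 F) * q₂ := by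
      have hm' := congrArg (fun x : ℤ => (x : 𝓞 F)) hm
      push_cast at hm'
      rw [hm']
      linear_combination 4 * hxe
    have h3 : (q₁ : 𝓞 F) * q₂ ∈ P := by
      rw [← this]
      exact Ideal.pow_mem_of_mem _ h 2 (by norm_num)
    rcases hP.mem_or_mem h3 with h | h
    · exact h1 h
    · exact h2 h

open Polynomial in
theorem ramK_aux (n : ℕ) (c : K) (hc : c ^ 2 = (n : K)) (hgen : Algebra.adjoin F {c} = ⊤)
    (P : Ideal (𝓞 K)) (hP : P.IsPrime) (h1 : (2 : 𝓞 K) ∉ P) (h2 : (n : 𝓞 K) ∉ P)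
    (p : Ideal (𝓞 F)) (hp : p.IsPrime) (hp0 : p ≠ ⊥) :
    ¬ P ^ 2 ∣ p.map (algebraMap (𝓞 F) (𝓞 K)) := by
  have hInt : IsIntegral ℤ c := by
    refine ⟨X ^ 2 - C (n : ℤ), ?_, ?_⟩
    · monicity!
    · simp [hc]
  set x : 𝓞 K := ⟨c, hInt⟩ with hx
  have hxe : x ^ 2 = (n : 𝓞 K) := by
    apply RingOfIntegers.coe_injective
    have : algebraMap (𝓞 K) K x = c := rfl
    simpa [this] using hc
  refine not_sq_dvd F K x (X ^ 2 - C (n : 𝓞 F)) ?_ hgen P ?_ p hp hp0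
  · simp [hxe]
  · simp only [derivative_sub, derivative_X_pow, derivative_C]
    simp
    rw [show algebraMap (𝓞 F) (𝓞 K) 2 = (2 : 𝓞 K) from map_ofNat _ 2]
    intro h
    rcases hP.mem_or_mem h with h | h
    · exact h1 h
    · apply h2
      rw [← hxe]
      exact Ideal.pow_mem_of_mem _ h 2 (by norm_num)

theorem not_both {P : Ideal (𝓞 K)} (hP : P.IsPrime) {m n : ℕ} (h : Nat.Coprime m n)
    (h1 : (m : 𝓞 K) ∈ P) (h2 : (n : 𝓞 K) ∈ P) : False := by
  apply hP.ne_top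
  rw [Ideal.eq_top_iff_one]
  have := Int.gcd_eq_gcd_ab m n
  rw [Int.gcd_natCast_natCast, h] at this
  have h3 := congrArg (fun x : ℤ => (x : 𝓞 K)) this
  push_cast at h3
  rw [h3]
  exact add_mem (Ideal.mul_mem_right _ _ h1) (Ideal.mul_mem_right _ _ h2)

theorem FD.mul (H : Hyp q₁ q₂ r δ δ') (D : FD q₁ q₂ r δ F K a b) : (algebraMap F K a) ^ 2 = δ * δ' := by
  rw [← map_pow, D.ha]
  rcases H.hδ with ⟨rfl, rfl⟩ | ⟨rfl, rfl⟩
  · simp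
  · simp [mul_comm]

theorem Hyp.cop (H : Hyp q₁ q₂ r δ δ') : Nat.Coprime δ δ' := by
  have := (Nat.coprime_primes H.hq₁ H.hq₂).2 H.hne
  rcases H.hδ with ⟨rfl, rfl⟩ | ⟨rfl, rfl⟩
  · exact this
  · exact this.symm

theorem Hyp.pδ (H : Hyp q₁ q₂ r δ δ') : δ.Prime := by
  rcases H.hδ with ⟨rfl, rfl⟩ | ⟨rfl, rfl⟩
  · exact H.hq₁
  · exact H.hq₂

theorem FD.hb' (D : FD q₁ q₂ r δ F K a b) : b ^ 2 = 2 * r * δ := by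
  rw [D.hb, map_mul, map_mul, map_ofNat, map_natCast, map_natCast]

theorem ramK (H : Hyp q₁ q₂ r δ δ') (D : FD q₁ q₂ r δ F K a b) (P : Ideal (𝓞 K))
    (hP : P.IsPrime) (h1 : (2 : 𝓞 K) ∉ P) (h2 : (r : 𝓞 K) ∉ P) (p : Ideal (𝓞 F))
    (hp : p.IsPrime) (hp0 : p ≠ ⊥) : ¬ P ^ 2 ∣ p.map (algebraMap (𝓞 F) (𝓞 K)) := by
  have hδ0 : (δ : K) ≠ 0 := by exact_mod_cast H.pδ.ne_zero
  have hgen : ∀ c : K, b ∈ Algebra.adjoin F {c} → Algebra.adjoin F {c} = ⊤ := by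
    intro c hc
    rw [eq_top_iff]
    intro y _
    obtain ⟨u, v, rfl⟩ := quad_repr D.finK _ D.nsK b D.hb y
    exact add_mem (Subalgebra.algebraMap_mem _ _) (mul_mem (Subalgebra.algebraMap_mem _ _) hc)
  by_cases h3 : (δ : 𝓞 K) ∈ P
  · have h4 : (δ' : 𝓞 K) ∉ P := fun h => not_both hP H.cop h3 h
    refine ramK_aux (2 * r * δ') (algebraMap F K (a / δ) * b) ?_ (hgen _ ?_) P hP h1 ?_ p hp hp0
    · have e1 := D.mul H
      have e2 := D.hb'
      rw [mul_pow, e2, map_div₀, div_pow, e1]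
      simp
      field_simp
    · have hm : algebraMap F K (a / δ) * b ∈ Algebra.adjoin F {algebraMap F K (a / δ) * b} :=
        Algebra.subset_adjoin rfl
      have ha0 : a ≠ 0 := by
        rintro rfl
        apply D.nsF
        have := D.ha
        rw [zero_pow two_ne_zero] at this
        rw [(map_eq_zero_iff (algebraMap ℚ F) (algebraMap ℚ F).injective).1 this.symm]
        exact ⟨0, by simp⟩
      have : b = algebraMap F K (δ / a) * (algebraMap F K (a / δ) * b) := by
        rw [← mul_assoc, ← map_mul]
        have : (δ : F) ≠ 0 := by exact_mod_cast H.pδ.ne_zero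
        rw [div_mul_div_cancel₀ ha0, div_self this, map_one, one_mul]
      have h5 := mul_mem (Subalgebra.algebraMap_mem
        (Algebra.adjoin F {algebraMap F K (a / δ) * b}) (δ / a)) hm
      rwa [← this] at h5
    · push_cast
      intro h
      rcases hP.mem_or_mem h with h | h
      · rcases hP.mem_or_mem h with h | h
        · exact h1 h
        · exact h2 h
      · exact h4 h
  · refine ramK_aux (2 * r * δ) b ?_ (hgen _ (Algebra.subset_adjoin rfl)) P hP h1 ?_ p hp hp0
    · rw [D.hb']; simp
    · push_cast
      intro h
      rcases hP.mem_or_mem h with h | h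
      · rcases hP.mem_or_mem h with h | h
        · exact h1 h
        · exact h2 h
      · exact h3 h

end

theorem pow_par {L : Type*} [Field L] (t : L) (ht : t ≠ 0) (i : ℕ) :
    ∃ (e : Bool) (f : L), f ≠ 0 ∧ t ^ i = (if e then t else 1) * f ^ 2 := by
  rcases Nat.even_or_odd' i with ⟨k, rfl | rfl⟩
  · exact ⟨false, t ^ k, pow_ne_zero _ ht, by simp; ring⟩
  · exact ⟨true, t ^ k, pow_ne_zero _ ht, by simp; ring⟩

theorem int_par (z : ℤ) : ∃ e : Bool, z = (if e then -1 else 1) * (z.natAbs : ℤ) := by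
  rcases Int.natAbs_eq z with h | h
  · exact ⟨false, by simpa using h⟩
  · exact ⟨true, by simpa using h⟩

theorem rat_int (x : ℚ) (hx : x ≠ 0) : ∃ (z : ℤ) (f : ℚ), z ≠ 0 ∧ f ≠ 0 ∧ x = z * f ^ 2 := by
  refine ⟨x.num * x.den, 1 / x.den, ?_, ?_, ?_⟩
  · simpa using hx
  · simp
  · have : (x.den : ℚ) ≠ 0 := by simp
    push_cast
    nth_rewrite 1 [← Rat.num_div_den x]
    field_simp

section
variable {q₁ q₂ r δ δ' : ℕ} {F K : Type*} [Field F] [NumberField F] [Field K] [NumberField K]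
    [Algebra F K] {a : F} {b : K}

open UniqueFactorizationMonoid in
theorem zF (H : Hyp q₁ q₂ r δ δ') (D : FD q₁ q₂ r δ F K a b) (t₁ t₂ : ℕ) (ht₁ : t₁.Prime ∨ t₁ = 1)
    (ht₂ : t₂.Prime ∨ t₂ = 1) (z : ℤ) (hz : z ≠ 0)
    (h : ∀ P : Ideal (𝓞 F), P.IsPrime → P ≠ ⊥ → (t₁ : 𝓞 F) ∉ P → (t₂ : 𝓞 F) ∉ P →
      Even (Multiset.count P (normalizedFactors (Ideal.span {(z : 𝓞 F)})))) :
    z.natAbs ∈ Msub q₁ q₂ t₁ t₂ := by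
  have e : Ideal.absNorm (Ideal.span {z}) = z.natAbs := by
    rw [Ideal.absNorm_span_singleton]; simp
  rw [← e]
  apply absNorm_mem_Msub _ _ _ _ (Or.inl H.hq₁) (Or.inl H.hq₂) ht₁ ht₂
  · simpa using hz
  intro p hp hp0 h1 h2 h3 h4
  apply even_descend (B := 𝓞 F) z hz p hp hp0
  intro P hP hPp
  have mem : ∀ t : ℕ, (t : ℤ) ∉ p → (t : 𝓞 F) ∉ P := by
    intro t ht hh
    apply ht
    rw [← hPp, Ideal.mem_comap]
    simpa using hh
  refine ⟨ramF H D P hP (mem _ h1) (mem _ h2) p hp hp0, ?_⟩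
  have := h P hP ?_ (mem _ h3) (mem _ h4)
  · simpa using this
  · rintro rfl
    apply hp0
    rw [← hPp]
    rw [← RingHom.ker_eq_comap_bot, RingHom.ker_eq_bot_iff_eq_zero]
    simp

theorem SelP.normQ {y : F} (h : SelP F y) : ∃ c : ℚ, c ≠ 0 ∧
    (Algebra.norm ℚ y = c ^ 2 ∨ Algebra.norm ℚ y = - c ^ 2) := by
  have hy := h.ne_zero
  obtain ⟨n, θ, J, hn, hθ, hJ, h⟩ := h
  have h1 := congrArg (Algebra.norm ℚ) h
  have h2 := congrArg Ideal.absNorm hJ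
  rw [map_mul, map_pow] at h1
  rw [map_pow, Ideal.absNorm_span_singleton] at h2
  have h3 : (Algebra.norm ℤ θ : ℚ) = Algebra.norm ℚ (algebraMap (𝓞 F) F θ) := Algebra.coe_norm_int θ
  have hn0 : Algebra.norm ℚ (algebraMap (𝓞 F) F n) ≠ 0 := by simpa using hn
  rw [← h3] at h1
  have hJ0 : (Ideal.absNorm J : ℚ) ≠ 0 := by
    intro h
    have h' : Ideal.absNorm J = 0 := by exact_mod_cast h
    rw [Ideal.absNorm_eq_zero_iff] at h'
    subst h'
    simp at hJ
    exact hθ hJ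
  refine ⟨Ideal.absNorm J / Algebra.norm ℚ (algebraMap (𝓞 F) F n), div_ne_zero hJ0 hn0, ?_⟩
  rcases Int.natAbs_eq (Algebra.norm ℤ θ) with h4 | h4
  · left
    rw [h4, h2] at h1
    push_cast at h1
    field_simp
    linear_combination h1
  · right
    rw [h4, h2] at h1
    push_cast at h1
    field_simp
    linear_combination h1

theorem ndvd_neg_one {p : ℕ} (hp : p.Prime) : ¬ (p : ℤ) ∣ -1 := by
  rw [dvd_neg]
  intro h
  have : p ∣ 1 := by exact_mod_cast h
  exact hp.one_lt.ne' (by simpa using this)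

theorem stepB (H : Hyp q₁ q₂ r δ δ') (D : FD q₁ q₂ r δ F K a b) {y : F} (h : SelP F y) :
    ∃ (e e' : Bool) (f : F), f ≠ 0 ∧ y = ((if e then -1 else 1) * (if e' then (q₁ : F) else 1)) * f ^ 2 := by
  obtain ⟨c, hc, hN⟩ := h.normQ
  have hN' : Algebra.norm ℚ y = c ^ 2 := by
    rcases hN with hN | hN
    · exact hN
    · exfalso
      obtain ⟨u, v, rfl⟩ := quad_repr D.finF _ D.nsF a D.ha y
      rw [quad_norm D.finF _ D.nsF a D.ha] at hN
      apply H.neg_one_q1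
      have := norm_res H.hq₁ H.q1_ndvd u v c hc (-1) (ndvd_neg_one H.hq₁) (by rw [hN]; simp)
      simpa using this
  obtain ⟨x, f, hx, hf, rfl⟩ := quad_sq D.finF _ D.nsF a D.ha y h.ne_zero c hN'
  obtain ⟨z, g, hz, hg, rfl⟩ := rat_int x hx
  have hg' : algebraMap ℚ F g ≠ 0 := by simpa using hg
  have hsel : SelP F (z : F) := by
    have := h.of_mul_sq hf
    rw [map_mul, map_pow] at this
    have := this.of_mul_sq hg'
    simpa using this
  have hm := zF H D 1 1 (Or.inr rfl) (Or.inr rfl) z hz (by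
    intro P hP _ _ _
    apply SelP.even_count
    simpa using hsel)
  obtain ⟨i, j, _, _, w, hw⟩ := hm
  simp at hw
  have q10 : (q₁ : F) ≠ 0 := by exact_mod_cast H.hq₁.ne_zero
  have q20 : (q₂ : F) ≠ 0 := by exact_mod_cast H.hq₂.ne_zero
  have hq2 : (q₂ : F) = q₁ * (a / q₁) ^ 2 := by
    rw [div_pow, D.ha]
    simp
    field_simp
  have ha0 : a / q₁ ≠ 0 := by
    intro h
    rw [h] at hq2
    apply q20
    rw [hq2]; simp
  obtain ⟨e, he⟩ := int_par z
  obtain ⟨e', f', hf', he'⟩ := pow_par (q₁ : F) q10 (i + j)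
  have hw0 : (w : F) ≠ 0 := by
    intro h
    have : w = 0 := by exact_mod_cast h
    subst this
    apply hz
    simpa using hw
  refine ⟨e, e', f * algebraMap ℚ F g * f' * (a / q₁) ^ j * w, by positivity, ?_⟩
  have hz' : (z : F) = (if e then -1 else 1) * (q₁ ^ i * q₂ ^ j * w ^ 2) := by
    have := congrArg (fun x : ℤ => (x : F)) he
    rw [hw] at this
    push_cast at this
    simpa using this
  have : algebraMap ℚ F (z : ℚ) = (z : F) := by simp
  rw [map_mul, this, hz', map_pow]
  have h4 : (q₁ : F) ^ i * q₂ ^ j = ((if e' = true then (q₁ : F) else 1) * f' ^ 2) * ((a / q₁) ^ j) ^ 2 := by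
    rw [← he']
    nth_rewrite 1 [hq2]
    ring
  rw [h4]
  ring
end

theorem eq_of_mul_eq {L : Type*} [Field L] {x c y g : L} (hc : c ≠ 0) (h : x * c = y * g ^ 2) :
    x = c * y * (g / c) ^ 2 := by
  field_simp
  linear_combination h

section
variable {q₁ q₂ r δ δ' : ℕ} {F K : Type*} [Field F] [NumberField F] [Field K] [NumberField K]
    [Algebra F K] {a : F} {b : K}

open UniqueFactorizationMonoid in
theorem evK (H : Hyp q₁ q₂ r δ δ') (D : FD q₁ q₂ r δ F K a b) (θ : 𝓞 F) (hθ : θ ≠ 0)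
    (h : SelP K (algebraMap F K (algebraMap (𝓞 F) F θ))) (p : Ideal (𝓞 F)) (hp : p.IsPrime)
    (hp0 : p ≠ ⊥) (h1 : ((2 : ℕ) : 𝓞 F) ∉ p) (h2 : (r : 𝓞 F) ∉ p) :
    Even (Multiset.count p (normalizedFactors (Ideal.span {θ}))) := by
  apply even_descend (B := 𝓞 K) θ hθ p hp hp0
  intro P hP hPp
  have mem : ∀ t : ℕ, (t : 𝓞 F) ∉ p → (t : 𝓞 K) ∉ P := by
    intro t ht hh
    apply ht
    rw [← hPp, Ideal.mem_comap]
    simpa using hh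
  refine ⟨ramK H D P hP (by simpa using mem _ h1) (mem _ h2) p hp hp0, ?_⟩
  apply SelP.even_count
  exact h

theorem Hyp.ndvd_r1 (H : Hyp q₁ q₂ r δ δ') : ¬ q₁ ∣ r := fun h =>
  H.hr1 ((Nat.prime_dvd_prime_iff_eq H.hq₁ H.hr).1 h).symm
theorem Hyp.ndvd_r2 (H : Hyp q₁ q₂ r δ δ') : ¬ q₂ ∣ r := fun h =>
  H.hr2 ((Nat.prime_dvd_prime_iff_eq H.hq₂ H.hr).1 h).symm
theorem Hyp.ndvd_21 (H : Hyp q₁ q₂ r δ δ') : ¬ q₁ ∣ 2 := fun h => by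
  have := (Nat.prime_dvd_prime_iff_eq H.hq₁ Nat.prime_two).1 h
  have := H.hq₁8
  omega
theorem Hyp.ndvd_22 (H : Hyp q₁ q₂ r δ δ') : ¬ q₂ ∣ 2 := fun h => by
  have := (Nat.prime_dvd_prime_iff_eq H.hq₂ Nat.prime_two).1 h
  have := H.hq₂8
  omega

theorem signpow_res {q q' : ℕ} (hq : q.Prime) (h : ¬ q ∣ q') (u v : ℚ) (i j w : ℕ) (hw : w ≠ 0)
    (n2 : ¬ q ∣ 2) (nr : ¬ q ∣ r) (sr : IsSquare (r : ZMod q)) (f : ℚ) (hf : f ≠ 0)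
    (e : ℤ) (he : ¬ (q : ℤ) ∣ e)
    (eq : (u ^ 2 - (q * q') * v ^ 2) * f ^ 2 = e * (2 ^ i * r ^ j * w ^ 2)) :
    IsSquare ((e * 2 ^ i : ℤ) : ZMod q) := by
  have : Fact q.Prime := ⟨hq⟩
  have hqz : Prime (q : ℤ) := Nat.prime_iff_prime_int.1 hq
  have hn2 : ¬ (q : ℤ) ∣ 2 := by exact_mod_cast n2
  have hnr : ¬ (q : ℤ) ∣ r := by exact_mod_cast nr
  have := norm_res hq h u v (w / f) (by positivity) (e * 2 ^ i * r ^ j) (by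
      intro hd
      rcases hqz.dvd_or_dvd hd with hd | hd
      · rcases hqz.dvd_or_dvd hd with hd | hd
        · exact he hd
        · exact hn2 (hqz.dvd_of_dvd_pow hd)
      · exact hnr (hqz.dvd_of_dvd_pow hd)) (by
      push_cast
      field_simp
      linear_combination eq)
  obtain ⟨s, hs⟩ := sr
  have hr0 : (r : ZMod q) ≠ 0 := by rwa [Ne, ZMod.natCast_eq_zero_iff]
  have hs0 : s ≠ 0 := by rintro rfl; exact hr0 (by simpa using hs)
  obtain ⟨t, ht⟩ := this
  refine ⟨t / s ^ j, ?_⟩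
  push_cast at ht ⊢
  rw [hs] at ht
  field_simp
  linear_combination ht

theorem stepD (H : Hyp q₁ q₂ r δ δ') (D : FD q₁ q₂ r δ F K a b) (y : F)
    (h : SelP K (algebraMap F K y)) :
    ∃ (e : Bool) (c : ℚ), c ≠ 0 ∧ Algebra.norm ℚ y = (if e then (r : ℚ) else 1) * c ^ 2 := by
  have hy : y ≠ 0 := by
    have := h.ne_zero
    rintro rfl
    simp at this
  obtain ⟨m, l, hl, hml⟩ := exists_den y
  have hl' := coe_ne_zero' hl
  have hm : m ≠ 0 := by
    rintro rfl
    simp at hml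
    tauto
  have hθ : algebraMap (𝓞 F) F (m * l) = y * (algebraMap (𝓞 F) F l) ^ 2 := by
    rw [map_mul, ← hml]; ring
  have hsel : SelP K (algebraMap F K (algebraMap (𝓞 F) F (m * l))) := by
    rw [hθ, map_mul, map_pow]
    exact h.mul (SelP.sq (by simpa using hl))
  have hmem := absNorm_mem_Msub 2 r 1 1 (Or.inl Nat.prime_two) (Or.inl H.hr) (Or.inr rfl)
    (Or.inr rfl) (Ideal.span {m * l}) (by simpa using ⟨hm, hl⟩) (by
      intro P hP hP0 h1 h2 _ _
      exact evK H D (m * l) (mul_ne_zero hm hl) hsel P hP hP0 h1 h2)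
  obtain ⟨i, j, _, _, w, hw⟩ := hmem
  simp only [one_pow, mul_one, Ideal.absNorm_span_singleton] at hw
  have hw0 : w ≠ 0 := by
    rintro rfl
    simp at hw
    tauto
  have h3 : (Algebra.norm ℤ (m * l) : ℚ) = Algebra.norm ℚ (algebraMap (𝓞 F) F (m * l)) :=
    Algebra.coe_norm_int _
  rw [hθ, map_mul (Algebra.norm ℚ), map_pow] at h3
  have hf : Algebra.norm ℚ (algebraMap (𝓞 F) F l) ≠ 0 := by simpa using hl
  set f := Algebra.norm ℚ (algebraMap (𝓞 F) F l) with hfdef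
  obtain ⟨e, he⟩ : ∃ e : Bool, Algebra.norm ℤ (m * l) = (if e then -1 else 1) * ((2 ^ i * r ^ j * w ^ 2 : ℕ) : ℤ) := by
    rw [← hw]; exact int_par _
  set N := Algebra.norm ℤ (m * l)
  obtain ⟨u, v, rfl⟩ := quad_repr D.finF _ D.nsF a D.ha y
  rw [quad_norm D.finF _ D.nsF a D.ha, he] at h3
  rw [quad_norm D.finF _ D.nsF a D.ha]
  have hodd : ∀ q q' : ℕ, q.Prime → ¬ q ∣ q' → (q : ℚ) * q' = q₁ * q₂ → ¬ q ∣ 2 → ¬ q ∣ r →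
      IsSquare (r : ZMod q) → IsSquare ((((if e then -1 else 1) * 2 ^ i : ℤ)) : ZMod q) := by
    intro q q' hq hq' hqq n2 nr sr
    have : Fact q.Prime := ⟨hq⟩
    apply signpow_res hq hq' u v i j w hw0 n2 nr sr f hf
    · cases e
      · simpa using (ndvd_neg_one hq)
      · simpa using (ndvd_neg_one hq)
    · rw [hqq, ← h3]; push_cast; ring
  have Q1 := hodd q₁ q₂ H.hq₁ H.q1_ndvd rfl H.ndvd_21 H.ndvd_r1 H.r_q1
  have Q2 := hodd q₂ q₁ H.hq₂ H.q2_ndvd (mul_comm _ _) H.ndvd_22 H.ndvd_r2 H.r_q2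
  have he' : e = false := by
    by_contra hne
    have : e = true := by simpa using hne
    subst this
    apply H.neg_one_q1
    have : Fact q₁.Prime := ⟨H.hq₁⟩
    have h20 : ((2 : ℕ) : ZMod q₁) ≠ 0 := by rw [Ne, ZMod.natCast_eq_zero_iff]; exact H.ndvd_21
    obtain ⟨s, hs⟩ := H.two_q1
    have hs0 : s ≠ 0 := by
      rintro rfl
      apply h20
      simpa using hs
    obtain ⟨t, ht⟩ := Q1
    push_cast at ht
    simp only [if_true] at ht
    rw [hs] at ht
    refine ⟨t / s ^ i, ?_⟩
    field_simp
    linear_combination ht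
  subst he'
  simp only [Bool.false_eq_true, if_false, one_mul] at Q2 h3
  have hi : Even i := by
    rw [← Nat.not_odd_iff_even]
    rintro ⟨k, rfl⟩
    apply H.two_q2
    have : Fact q₂.Prime := ⟨H.hq₂⟩
    have h20 : ((2 : ℕ) : ZMod q₂) ≠ 0 := by rw [Ne, ZMod.natCast_eq_zero_iff]; exact H.ndvd_22
    have h20' : (2 : ZMod q₂) ≠ 0 := by simpa using h20
    obtain ⟨t, ht⟩ := Q2
    push_cast at ht
    refine ⟨t / 2 ^ k, ?_⟩
    field_simp
    linear_combination ht
  obtain ⟨k, rfl⟩ := hi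
  obtain ⟨e', g, hg, hge⟩ := pow_par (r : ℚ) (by exact_mod_cast H.hr.ne_zero) j
  refine ⟨e', 2 ^ k * g * w / f, by positivity, ?_⟩
  push_cast at h3
  rw [hge] at h3
  field_simp
  linear_combination -h3

theorem FD.q2_eq (H : Hyp q₁ q₂ r δ δ') (D : FD q₁ q₂ r δ F K a b) :
    ∃ g : K, g ≠ 0 ∧ (q₂ : K) = q₁ * g ^ 2 := by
  have q10 : (q₁ : K) ≠ 0 := by exact_mod_cast H.hq₁.ne_zero
  have q20 : (q₂ : K) ≠ 0 := by exact_mod_cast H.hq₂.ne_zero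
  have e : (algebraMap F K a) ^ 2 = q₁ * q₂ := by rw [← map_pow, D.ha]; simp
  have : (q₂ : K) = q₁ * (algebraMap F K a / q₁) ^ 2 := by
    rw [div_pow, e]
    field_simp
  refine ⟨_, ?_, this⟩
  intro h
  rw [h] at this
  apply q20
  rw [this]; simp

theorem FD.r_eq (H : Hyp q₁ q₂ r δ δ') (D : FD q₁ q₂ r δ F K a b) :
    ∃ g : K, g ≠ 0 ∧ (r : K) = 2 * q₁ * g ^ 2 := by
  have q10 : (q₁ : K) ≠ 0 := by exact_mod_cast H.hq₁.ne_zero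
  have q20 : (q₂ : K) ≠ 0 := by exact_mod_cast H.hq₂.ne_zero
  have r0 : (r : K) ≠ 0 := by exact_mod_cast H.hr.ne_zero
  have e := D.hb'
  obtain ⟨g, hg, h⟩ := D.q2_eq H
  have key : ∃ g : K, (r : K) = 2 * q₁ * g ^ 2 := by
    rcases H.hδ with ⟨rfl, rfl⟩ | ⟨rfl, rfl⟩
    · refine ⟨b / (2 * δ), ?_⟩
      rw [div_pow, e]
      field_simp
    · refine ⟨g * b / (2 * δ), ?_⟩
      rw [div_pow, mul_pow, e]
      field_simp
      linear_combination h
  obtain ⟨g', hg'⟩ := key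
  refine ⟨g', ?_, hg'⟩
  rintro rfl
  apply r0
  rw [hg']; simp

def ratRep (q₁ : ℕ) (K : Type*) [Field K] (e : Bool × Bool × Bool) : K :=
  (if e.1 then -1 else 1) * (if e.2.1 then 2 else 1) * (if e.2.2 then (q₁ : K) else 1)

theorem stepE (H : Hyp q₁ q₂ r δ δ') (D : FD q₁ q₂ r δ F K a b) (x : ℚ)
    (h : SelP K (algebraMap F K (algebraMap ℚ F x))) :
    ∃ (e : Bool × Bool × Bool) (f : K), f ≠ 0 ∧ algebraMap F K (algebraMap ℚ F x) = ratRep q₁ K e * f ^ 2 := by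
  have hx : x ≠ 0 := by
    rintro rfl
    exact h.ne_zero (by simp)
  obtain ⟨z, g, hz, hg, rfl⟩ := rat_int x hx
  have hg' : algebraMap F K (algebraMap ℚ F g) ≠ 0 := by simpa using hg
  rw [map_mul, map_mul, map_pow, map_pow] at h
  have hsel := h.of_mul_sq hg'
  have hm := zF H D 2 r (Or.inl Nat.prime_two) (Or.inl H.hr) z hz (by
    intro P hP hP0 h1 h2
    apply evK H D (z : 𝓞 F) (by exact_mod_cast hz) _ P hP hP0 h1 h2
    simpa using hsel)
  obtain ⟨i, j, k, l, w, hw⟩ := hm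
  have q10 : (q₁ : K) ≠ 0 := by exact_mod_cast H.hq₁.ne_zero
  have hw0 : (w : K) ≠ 0 := by
    intro h
    have : w = 0 := by exact_mod_cast h
    subst this
    apply hz
    simpa using hw
  obtain ⟨g1, hg1, e1⟩ := D.q2_eq H
  obtain ⟨g2, hg2, e2⟩ := D.r_eq H
  obtain ⟨e, he⟩ := int_par z
  obtain ⟨e', f', hf', he'⟩ := pow_par (2 : K) two_ne_zero (k + l)
  obtain ⟨e'', f'', hf'', he''⟩ := pow_par (q₁ : K) q10 (i + j + l)
  refine ⟨(e, e', e''), algebraMap F K (algebraMap ℚ F g) * w * f' * f'' * g1 ^ j * g2 ^ l,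
    by positivity, ?_⟩
  have hz' : (z : K) = (if e then -1 else 1) * (q₁ ^ i * q₂ ^ j * 2 ^ k * r ^ l * w ^ 2) := by
    have := congrArg (fun x : ℤ => (x : K)) he
    rw [hw] at this
    push_cast at this
    simpa using this
  have : algebraMap F K (algebraMap ℚ F (z : ℚ)) = (z : K) := by simp
  rw [map_mul, map_mul, this, hz', map_pow, map_pow, e1, e2]
  simp only [ratRep]
  set A := if e = true then (-1 : K) else 1
  set B := if e' = true then (2 : K) else 1
  set C := if e'' = true then (q₁ : K) else 1
  have e3 : (q₁ : K) ^ i * (q₁ * g1 ^ 2) ^ j * 2 ^ k * (2 * q₁ * g2 ^ 2) ^ l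
      = (2 ^ (k + l)) * (q₁ ^ (i + j + l)) * (g1 ^ j * g2 ^ l) ^ 2 := by ring
  rw [e3, he', he'']
  ring

theorem selmer_bound (H : Hyp q₁ q₂ r δ δ') (D : FD q₁ q₂ r δ F K a b) :
    ∃ G : (Bool × Bool) × Bool × (Bool × Bool × Bool) → K, ∀ β, SelP K β →
      ∃ i k, k ≠ 0 ∧ β = G i * k ^ 2 := by
  classical
  let s : Bool × Bool → F := fun e => (if e.1 then -1 else 1) * (if e.2 then (q₁ : F) else 1)
  have hB : ∀ e : Bool × Bool, ∃ B : K, ∀ β, SelP K β → (∃ f, f ≠ 0 ∧ Algebra.norm F β = s e * f ^ 2) →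
      SelP K B ∧ (∃ f, f ≠ 0 ∧ Algebra.norm F B = s e * f ^ 2) := by
    intro e
    by_cases h : ∃ β, SelP K β ∧ (∃ f, f ≠ 0 ∧ Algebra.norm F β = s e * f ^ 2)
    · obtain ⟨β, h⟩ := h
      exact ⟨β, fun _ _ _ => h⟩
    · exact ⟨0, fun β h1 h2 => (h ⟨β, h1, h2⟩).elim⟩
  choose B hB using hB
  let t : Bool → ℚ := fun e => (if e then (r : ℚ) else 1)
  have hC : ∀ e : Bool, ∃ C : F, ∀ y, SelP K (algebraMap F K y) → (∃ c, c ≠ 0 ∧ Algebra.norm ℚ y = t e * c ^ 2) →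
      SelP K (algebraMap F K C) ∧ (∃ c, c ≠ 0 ∧ Algebra.norm ℚ C = t e * c ^ 2) := by
    intro e
    by_cases h : ∃ y, SelP K (algebraMap F K y) ∧ (∃ c, c ≠ 0 ∧ Algebra.norm ℚ y = t e * c ^ 2)
    · obtain ⟨β, h⟩ := h
      exact ⟨β, fun _ _ _ => h⟩
    · exact ⟨0, fun β h1 h2 => (h ⟨β, h1, h2⟩).elim⟩
  choose C hC using hC
  refine ⟨fun i => B i.1 * (algebraMap F K (C i.2.1) * ratRep q₁ K i.2.2), ?_⟩
  intro β hβ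
  obtain ⟨e1, e2, f, hf, hN⟩ := stepB H D hβ.norm (y := Algebra.norm F β)
  obtain ⟨hBs, f', hf', hBN⟩ := hB (e1, e2) β hβ ⟨f, hf, hN⟩
  have hprod := hβ.mul hBs
  obtain ⟨y, g, hy, hg, hyg⟩ := quad_sq D.finK _ D.nsK b D.hb (β * B (e1, e2)) hprod.ne_zero
    (s (e1, e2) * f * f') (by rw [map_mul, hBN, hN]; ring)
  have hselY : SelP K (algebraMap F K y) := by
    rw [hyg] at hprod
    exact hprod.of_mul_sq hg
  obtain ⟨e3, c, hc, hcN⟩ := stepD H D y hselY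
  obtain ⟨hCs, c', hc', hCN⟩ := hC e3 y hselY ⟨c, hc, hcN⟩
  have hprod2 := hselY.mul hCs
  have hC0 := hCs.ne_zero
  have hB0 := hBs.ne_zero
  obtain ⟨x, g', hx, hg', hxg⟩ := quad_sq D.finF _ D.nsF a D.ha (y * C e3)
    (mul_ne_zero hy (by rintro h; rw [h] at hC0; simp at hC0))
    (t e3 * c * c') (by rw [map_mul, hCN, hcN]; ring)
  have hg'0 : algebraMap F K g' ≠ 0 := by simpa using hg'
  rw [← map_mul, hxg, map_mul, map_pow] at hprod2
  have hselX := hprod2.of_mul_sq hg'0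
  obtain ⟨e, k, hk, he⟩ := stepE H D x hselX
  have h1 := eq_of_mul_eq hB0 hyg
  have h2' := congrArg (algebraMap F K) hxg
  rw [map_mul, map_mul, map_pow] at h2'
  have h2 := eq_of_mul_eq hC0 h2'
  refine ⟨((e1, e2), e3, e), g / B (e1, e2) * (algebraMap F K g' / algebraMap F K (C e3)) * k,
    by positivity, ?_⟩
  rw [h1, h2, he]
  ring
end

section
variable (K : Type*) [Field K] [NumberField K]

open NumberField.Units in
/-- representatives of units modulo squares -/
noncomputable def uu (s : Bool) (e : Fin (rank K) → Bool) : (𝓞 K)ˣ :=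
  (if s then -1 else 1) * ∏ i, fundSystem K i ^ (if e i then (1 : ℤ) else 0)

open NumberField.Units in
theorem uu_inj (hneg : ∀ k : K, k ^ 2 ≠ -1) (s s' : Bool) (e e' : Fin (rank K) → Bool) (v : (𝓞 K)ˣ)
    (h : uu K s e = uu K s' e' * v ^ 2) : s = s' ∧ e = e' := by
  have neg_mem : ∀ s : Bool, (if s then (-1 : (𝓞 K)ˣ) else 1) ∈ torsion K := by
    intro s
    cases s
    · simp
    · simp only [if_true]
      rw [torsion, CommGroup.mem_torsion]
      exact isOfFinOrder_iff_pow_eq_one.2 ⟨2, by norm_num, by simp⟩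
  have he : e = e' := by
    obtain ⟨⟨ζ, n⟩, hv, -⟩ := exist_unique_eq_mul_prod K v
    simp only at hv
    have h1 := fun_eq_repr K (x := uu K s e) (neg_mem s) rfl
    have h2 := fun_eq_repr K (x := uu K s e) (ζ := (if s' then (-1 : (𝓞 K)ˣ) else 1) * ζ ^ 2)
      (f := fun i => (if e' i then (1 : ℤ) else 0) + 2 * n i)
      (mul_mem (neg_mem s') (pow_mem ζ.2 2)) (by
        rw [h, hv, uu]
        simp only [zpow_add, Finset.prod_mul_distrib, mul_comm (2 : ℤ), zpow_mul, zpow_ofNat, Finset.prod_pow, mul_pow]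
        simp only [mul_assoc, mul_left_comm])
    rw [← h2] at h1
    funext i
    have := congrFun h1 i
    revert this
    cases e i <;> cases e' i <;> simp <;> omega
  refine ⟨?_, he⟩
  subst he
  rw [uu, uu, mul_right_comm, mul_left_inj] at h
  by_contra hne
  have key : v ^ 2 = -1 := by
    cases s <;> cases s' <;> simp at h hne ⊢
    · rw [h]; simp
    · exact h.symm
  apply hneg (algebraMap (𝓞 K) K v)
  rw [← map_pow]
  have := congrArg (fun u : (𝓞 K)ˣ => algebraMap (𝓞 K) K u) key
  simpa using this

theorem unit_of_sq (u : (𝓞 K)ˣ) (k : K) (h : k ^ 2 = algebraMap (𝓞 K) K u) :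
    ∃ v : (𝓞 K)ˣ, algebraMap (𝓞 K) K v = k := by
  have hInt : IsIntegral ℤ k := by
    have : IsIntegral ℤ (k ^ 2) := by rw [h]; exact RingOfIntegers.isIntegral_coe _
    exact IsIntegral.of_pow (by norm_num) this
  set x : 𝓞 K := ⟨k, hInt⟩
  have hx : x ^ 2 = u := by
    apply RingOfIntegers.coe_injective
    rw [map_pow]; exact h
  have : IsUnit x := by
    have h2 : IsUnit (x ^ 2) := by rw [hx]; exact u.isUnit
    exact (isUnit_pow_iff two_ne_zero).1 h2
  obtain ⟨v, hv⟩ := this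
  exact ⟨v, by rw [hv]; rfl⟩

open nonZeroDivisors in
theorem upper_bound (hneg : ∀ k : K, k ^ 2 ≠ -1) (hrk : Units.rank K = 3)
    (hG : ∃ G : (Bool × Bool) × Bool × (Bool × Bool × Bool) → K, ∀ β, SelP K β →
      ∃ i k, k ≠ 0 ∧ β = G i * k ^ 2) :
    Nat.card {x : ClassGroup (𝓞 K) // x ^ 2 = 1} ≤ 4 := by
  classical
  obtain ⟨G, hG⟩ := hG
  have h1 : ∀ c : {x : ClassGroup (𝓞 K) // x ^ 2 = 1}, ∃ (J : (Ideal (𝓞 K))⁰) (β : 𝓞 K), β ≠ 0 ∧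
      ClassGroup.mk0 J = c.1 ∧ Ideal.span {β} = (J : Ideal (𝓞 K)) ^ 2 := by
    rintro ⟨c, hc⟩
    obtain ⟨J, rfl⟩ := ClassGroup.mk0_surjective c
    rw [← map_pow] at hc
    have hc' : ClassGroup.mk0 ⟨(J : Ideal (𝓞 K)) ^ 2, pow_mem J.2 2⟩ = 1 := hc
    obtain ⟨β, hβ⟩ := ((ClassGroup.mk0_eq_one_iff (pow_mem J.2 2)).1 hc').principal
    have hJ : (J : Ideal (𝓞 K)) ^ 2 = Ideal.span {β} := hβ
    refine ⟨J, β, ?_, rfl, hJ.symm⟩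
    rintro rfl
    simp at hJ
    exact nonZeroDivisors.ne_zero (pow_mem J.2 2) hJ
  choose J β hβ hJ hJβ using h1
  have hsel : ∀ c (u : (𝓞 K)ˣ), SelP K (algebraMap (𝓞 K) K (u * β c)) := by
    intro c u
    refine ⟨1, u * β c, J c, one_ne_zero, mul_ne_zero u.ne_zero (hβ c), ?_, by simp⟩
    rw [← hJβ, Ideal.span_singleton_mul_left_unit u.isUnit]
  choose ix kk hkk hix using fun c u => hG _ (hsel c u)
  let Φ : {x : ClassGroup (𝓞 K) // x ^ 2 = 1} × Bool × (Fin (Units.rank K) → Bool) →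
      (Bool × Bool) × Bool × (Bool × Bool × Bool) := fun t => ix t.1 (uu K t.2.1 t.2.2)
  have hΦ : Function.Injective Φ := by
    rintro ⟨c, s, e⟩ ⟨c', s', e'⟩ h
    simp only [Φ] at h
    set u := uu K s e with hu
    set u' := uu K s' e' with hu'
    have e1 := hix c u
    have e2 := hix c' u'
    rw [h] at e1
    set k := kk c u with hk
    set k' := kk c' u' with hk'
    have hk0 : k ≠ 0 := hkk c u
    have hk0' : k' ≠ 0 := hkk c' u'
    have e3 : algebraMap (𝓞 K) K (u * β c) = algebraMap (𝓞 K) K (u' * β c') * (k / k') ^ 2 := by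
      rw [e1, e2]; field_simp
    obtain ⟨m, l, hl, hml⟩ := exists_den (k / k')
    have hl' := coe_ne_zero' hl
    have hm : m ≠ 0 := by
      rintro rfl
      rw [map_zero] at hml
      exact (mul_ne_zero (div_ne_zero hk0 hk0') hl') hml
    have e4 : (u * β c) * l ^ 2 = (u' * β c') * m ^ 2 := by
      apply RingOfIntegers.coe_injective
      rw [map_mul, map_mul (algebraMap (𝓞 K) K) _ (m ^ 2), map_pow, map_pow, ← hml, e3]
      ring
    have hcc : c = c' := by
      apply Subtype.ext
      rw [← hJ, ← hJ, ClassGroup.mk0_eq_mk0_iff]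
      refine ⟨l, m, hl, hm, ?_⟩
      have e5 := congrArg (fun x => Ideal.span {x}) e4
      simp only [← Ideal.span_singleton_mul_span_singleton, ← Ideal.span_singleton_pow] at e5
      rw [Ideal.span_singleton_eq_top.2 u.isUnit, Ideal.span_singleton_eq_top.2 u'.isUnit,
        Ideal.top_mul, Ideal.top_mul, hJβ, hJβ, ← mul_pow, ← mul_pow] at e5
      rw [mul_comm, mul_comm (Ideal.span {m})]
      exact dvd_antisymm ((UniqueFactorizationMonoid.pow_dvd_pow_iff_dvd two_ne_zero).1 e5.dvd)
        ((UniqueFactorizationMonoid.pow_dvd_pow_iff_dvd two_ne_zero).1 e5.symm.dvd)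
    subst hcc
    have hβ' := coe_ne_zero' (hβ c)
    have e6 : (k / k') ^ 2 = algebraMap (𝓞 K) K ((u'⁻¹ * u : (𝓞 K)ˣ) : 𝓞 K) := by
      have hu0 := coe_ne_zero' u'.ne_zero
      rw [map_mul, map_mul] at e3
      have e7 : algebraMap (𝓞 K) K u = algebraMap (𝓞 K) K u' * (k / k') ^ 2 := by
        apply mul_right_cancel₀ hβ'
        rw [e3]; ring
      rw [Units.val_mul, map_mul, e7, ← mul_assoc, ← map_mul]
      simp
    obtain ⟨v, hv⟩ := unit_of_sq K _ _ e6
    rw [← hv] at e6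
    have e8 : u = u' * v ^ 2 := by
      apply Units.ext
      apply RingOfIntegers.coe_injective
      have : algebraMap (𝓞 K) K ((v ^ 2 : (𝓞 K)ˣ) : 𝓞 K) = algebraMap (𝓞 K) K v ^ 2 := by simp
      rw [Units.val_mul, map_mul, this, e6, ← map_mul, ← Units.val_mul]
      simp
    obtain ⟨rfl, rfl⟩ := uu_inj K hneg s s' e e' v e8
    rfl
  have := Nat.card_le_card_of_injective Φ hΦ
  rw [Nat.card_prod, Nat.card_prod, Nat.card_prod, Nat.card_prod, Nat.card_prod, Nat.card_prod,
    Nat.card_prod, Nat.card_fun, hrk] at this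
  simp only [Nat.card_eq_fintype_card (α := Bool), Nat.card_eq_fintype_card (α := Fin 3), Fintype.card_bool, Fintype.card_fin] at this
  omega
end

theorem group_four (G : Type*) [CommGroup G] [Finite G] (x y : G) (hx : ¬ IsSquare x)
    (hy : ¬ IsSquare y) (hxy : ¬ IsSquare (x * y)) : 4 ≤ Nat.card {x : G // x ^ 2 = 1} := by
  classical
  let f : G →* G := powMonoidHom 2
  have hmem : ∀ z, z ∈ f.range ↔ IsSquare z := by
    intro z
    constructor
    · rintro ⟨w, rfl⟩; exact ⟨w, by simp [f, sq]⟩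
    · rintro ⟨w, rfl⟩; exact ⟨w, by simp [f, sq]⟩
  have h1 : Nat.card {x : G // x ^ 2 = 1} = Nat.card f.ker := rfl
  have h2 : Nat.card f.ker = f.range.index := by
    have e1 := f.range.card_mul_index
    have e2 := f.ker.card_mul_index
    rw [Subgroup.index_ker] at e2
    have h0 : 0 < Nat.card f.range := Nat.card_pos
    rw [← e1, mul_comm] at e2
    exact Nat.eq_of_mul_eq_mul_left h0 e2
  rw [h1, h2, Subgroup.index]
  let g : Bool × Bool → G ⧸ f.range := fun e => (((if e.1 then x else 1) * (if e.2 then y else 1) : G) : G ⧸ f.range)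
  have hsq : ∀ z w : G, IsSquare z → IsSquare (z * w) → IsSquare w := by
    rintro z w ⟨s, rfl⟩ ⟨t, ht⟩
    refine ⟨s⁻¹ * t, ?_⟩
    rw [mul_mul_mul_comm, ← ht]
    group
  have hinv : ∀ z w : G, IsSquare (z⁻¹ * w) → IsSquare (z * w) := by
    rintro z w ⟨t, ht⟩
    refine ⟨z * t, ?_⟩
    rw [mul_mul_mul_comm, ← ht]
    group
  have hg : Function.Injective g := by
    rintro ⟨e1, e2⟩ ⟨e3, e4⟩ h
    have h' := QuotientGroup.eq.1 h
    rw [hmem] at h'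
    have h3 := hinv _ _ h'
    have hyx : ¬ IsSquare (y * x) := by rwa [mul_comm]
    have s1 : IsSquare (x * x) := ⟨x, rfl⟩
    have s2 : IsSquare (y * y) := ⟨y, rfl⟩
    have k1 : ¬ IsSquare (x * (x * y)) := fun h => hy (hsq (x * x) y s1 (by rwa [mul_assoc]))
    have k2 : ¬ IsSquare (y * (x * y)) := fun h => hx (hsq (y * y) x s2 (by
      rwa [mul_assoc, mul_comm y x]))
    have k3 : ¬ IsSquare (x * y * x) := by rwa [mul_comm]
    have k4 : ¬ IsSquare (x * y * y) := by rwa [mul_comm]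
    cases e1 <;> cases e2 <;> cases e3 <;> cases e4 <;> simp at h3 ⊢ <;> tauto
  have := Nat.card_le_card_of_injective g hg
  simpa using this

/-- an ideal of norm p from a p-adic embedding -/
theorem exists_ideal_norm (K : Type*) [Field K] [NumberField K] (p : ℕ) [Fact p.Prime]
    (φ : K →+* ℚ_[p]) : ∃ P : Ideal (𝓞 K), Ideal.absNorm P = p := by
  have hInt : ∀ x : 𝓞 K, φ (algebraMap (𝓞 K) K x) ∈ PadicInt.subring p := by
    intro x
    have h1 : IsIntegral ℤ (φ (algebraMap (𝓞 K) K x)) :=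
      (RingOfIntegers.isIntegral_coe x).map φ.toIntAlgHom
    have h2 : IsIntegral ℤ_[p] (φ (algebraMap (𝓞 K) K x)) := h1.tower_top
    obtain ⟨y, hy⟩ := IsIntegrallyClosed.isIntegral_iff.1 h2
    rw [← hy]
    exact y.2
  let ψ : 𝓞 K →+* ℤ_[p] := (φ.comp (algebraMap (𝓞 K) K)).codRestrict (PadicInt.subring p) hInt
  let χ : 𝓞 K →+* ZMod p := PadicInt.toZMod.comp ψ
  refine ⟨RingHom.ker χ, ?_⟩
  rw [Ideal.absNorm_apply, Submodule.cardQuot_apply]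
  have e := RingHom.quotientKerEquivOfSurjective (ZMod.ringHom_surjective χ)
  rw [show Nat.card (𝓞 K ⧸ RingHom.ker χ) = Nat.card (ZMod p) from Nat.card_congr e.toEquiv]
  exact Nat.card_zmod p

section
variable {q₁ q₂ r δ δ' : ℕ} {F K : Type*} [Field F] [NumberField F] [Field K] [NumberField K]
    [Algebra F K] {a : F} {b : K}

theorem exists_p (H : Hyp q₁ q₂ r δ δ') : ∃ p : ℕ, p.Prime ∧ 2 * q₁ * q₂ * r < p ∧ (p : ZMod r) = 2 ∧
    IsSquare (q₁ : ZMod p) ∧ IsSquare (q₂ : ZMod p) ∧ IsSquare (2 * r : ZMod p) := by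
  have c12 : Nat.Coprime q₁ q₂ := (Nat.coprime_primes H.hq₁ H.hq₂).2 H.hne
  have c1r : Nat.Coprime q₁ r := (Nat.coprime_primes H.hq₁ H.hr).2 H.hr1.symm
  have c2r : Nat.Coprime q₂ r := (Nat.coprime_primes H.hq₂ H.hr).2 H.hr2.symm
  have h1 := H.hq₁8
  have h2 := H.hq₂8
  have h3 := H.hr8
  have c8 : ∀ n : ℕ, n % 2 = 1 → Nat.Coprime 8 n := by
    intro n hn
    rw [show 8 = 2 ^ 3 by norm_num]
    apply Nat.Coprime.pow_left
    rw [Nat.coprime_two_left, Nat.odd_iff]; exact hn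
  have o1 := c8 q₁ (by omega)
  have o2 := c8 q₂ (by omega)
  have o3 := c8 r (by omega)
  obtain ⟨k1, hk1, hk1'⟩ := Nat.chineseRemainder (n := q₁ * q₂) (m := r)
    (Nat.Coprime.mul_left c1r c2r) 1 2
  obtain ⟨k2, hk2, hk2'⟩ := Nat.chineseRemainder (n := 8) (m := q₁ * q₂ * r)
    (Nat.Coprime.mul_right (Nat.Coprime.mul_right o1 o2) o3) 5 k1
  have m1 : k2 ≡ 1 [MOD q₁ * q₂] := (hk2'.of_mul_right _).trans hk1
  have m2 : k2 ≡ 2 [MOD r] := (hk2'.of_mul_left _).trans hk1'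
  have hcop : Nat.Coprime k2 (8 * (q₁ * q₂ * r)) := by
    apply Nat.Coprime.mul_right
    · rw [Nat.Coprime, hk2.gcd_eq]; norm_num
    · apply Nat.Coprime.mul_right
      · rw [Nat.Coprime, m1.gcd_eq]; simp
      · rw [Nat.Coprime, m2.gcd_eq]
        have : Nat.Coprime 2 r := by rw [Nat.coprime_two_left, Nat.odd_iff]; omega
        exact this
  have hpos : 8 * (q₁ * q₂ * r) ≠ 0 := by
    have := H.hq₁.ne_zero
    have := H.hq₂.ne_zero
    have := H.hr.ne_zero
    positivity
  obtain ⟨p, hpn, hp, hpm⟩ := Nat.forall_exists_prime_gt_and_modEq (2 * q₁ * q₂ * r) hpos hcop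
  have p8 : p % 8 = 5 := (hpm.of_mul_right _).trans hk2
  have pq : p ≡ 1 [MOD q₁ * q₂] := ((hpm.of_mul_left _).of_mul_right _).trans m1
  have pr : p ≡ 2 [MOD r] := ((hpm.of_mul_left _).of_mul_left _).trans m2
  have pr' : (p : ZMod r) = 2 := by
    have := (ZMod.natCast_eq_natCast_iff _ _ _).2 pr
    simpa using this
  have pq1 : (p : ZMod q₁) = 1 := by
    have := (ZMod.natCast_eq_natCast_iff _ _ _).2 (pq.of_mul_right _)
    simpa using this
  have pq2 : (p : ZMod q₂) = 1 := by
    have := (ZMod.natCast_eq_natCast_iff _ _ _).2 (pq.of_mul_left _)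
    simpa using this
  have : Fact p.Prime := ⟨hp⟩
  have : Fact r.Prime := ⟨H.hr⟩
  have : Fact q₁.Prime := ⟨H.hq₁⟩
  have : Fact q₂.Prime := ⟨H.hq₂⟩
  refine ⟨p, hp, hpn, pr', ?_, ?_, ?_⟩
  · exact (ZMod.exists_sq_eq_prime_iff_of_mod_four_eq_one (by omega) (by omega)).2 (by rw [pq1]; exact IsSquare.one)
  · exact (ZMod.exists_sq_eq_prime_iff_of_mod_four_eq_one (by omega) (by omega)).2 (by rw [pq2]; exact IsSquare.one)
  · have n2 : ¬ IsSquare (2 : ZMod p) := by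
      rw [ZMod.exists_sq_eq_two_iff (by omega)]; omega
    have nr : ¬ IsSquare (r : ZMod p) := by
      rw [ZMod.exists_sq_eq_prime_iff_of_mod_four_eq_one (by omega) (by omega), pr']
      exact H.two_r
    have r0 : (r : ZMod p) ≠ 0 := fun h => nr (by rw [h]; exact IsSquare.zero)
    have t0 : (2 : ZMod p) ≠ 0 := fun h => n2 (by rw [h]; exact IsSquare.zero)
    have n2' := (quadraticChar_neg_one_iff_not_isSquare (F := ZMod p)).2 n2
    have nr' := (quadraticChar_neg_one_iff_not_isSquare (F := ZMod p)).2 nr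
    rw [← quadraticChar_one_iff_isSquare (mul_ne_zero t0 r0), map_mul, n2', nr']
    norm_num

theorem exists_emb (H : Hyp q₁ q₂ r δ δ') (D : FD q₁ q₂ r δ F K a b) (p : ℕ) [Fact p.Prime]
    (hp : 2 * q₁ * q₂ * r < p) (s1 : IsSquare (q₁ : ZMod p)) (s2 : IsSquare (q₂ : ZMod p))
    (s3 : IsSquare (2 * r : ZMod p)) : Nonempty (K →+* ℚ_[p]) := by
  have hp2 : p ≠ 2 := by
    have := H.hq₁.pos
    have := H.hq₂.pos
    have := H.hr.pos
    have : 0 < q₁ * q₂ * r := by positivity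
    nlinarith
  have hpp : p.Prime := Fact.out
  have a1 := H.hq₁.pos
  have a2 := H.hq₂.pos
  have a3 := H.hr.pos
  have n1 : ¬ (p : ℤ) ∣ (q₁ * q₂ : ℕ) := by
    rw [Int.natCast_dvd_natCast]
    intro h
    have := Nat.le_of_dvd (by positivity) h
    have : q₁ * q₂ * 1 ≤ q₁ * q₂ * (2 * r) := Nat.mul_le_mul_left _ (by omega)
    nlinarith
  have n2 : ¬ (p : ℤ) ∣ (2 * r * δ : ℕ) := by
    rw [Int.natCast_dvd_natCast]
    intro h
    have h4 := Nat.le_of_dvd (by have := H.pδ.pos; positivity) h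
    have : δ ≤ q₁ * q₂ := by
      rcases H.hδ with ⟨rfl, rfl⟩ | ⟨rfl, rfl⟩
      · exact Nat.le_mul_of_pos_right _ a2
      · exact Nat.le_mul_of_pos_left _ a1
    have : 2 * r * δ ≤ 2 * r * (q₁ * q₂) := Nat.mul_le_mul_left _ this
    nlinarith
  have sδ : IsSquare (δ : ZMod p) := by
    rcases H.hδ with ⟨rfl, rfl⟩ | ⟨rfl, rfl⟩
    · exact s1
    · exact s2
  obtain ⟨t, ht⟩ := pad_sqrt hp2 _ n1 (by push_cast; exact s1.mul s2)
  obtain ⟨w, hw⟩ := pad_sqrt hp2 _ n2 (by push_cast; exact s3.mul sδ)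
  obtain ⟨φ, hφ⟩ := quad_hom D.finF _ D.nsF a D.ha t (by rw [ht]; simp)
  let _ : Algebra F ℚ_[p] := φ.toRingHom.toAlgebra
  obtain ⟨ψ, hψ⟩ := quad_hom D.finK _ D.nsK b D.hb w (by
    rw [hw, map_mul, map_mul, map_ofNat, map_natCast, map_natCast]; push_cast; ring)
  exact ⟨ψ.toRingHom⟩
end

theorem sq_inj_ideal {R : Type*} [CommRing R] [IsDedekindDomain R] {I J : Ideal R}
    (h : I ^ 2 = J ^ 2) : I = J :=
  dvd_antisymm ((UniqueFactorizationMonoid.pow_dvd_pow_iff_dvd two_ne_zero).1 h.dvd)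
    ((UniqueFactorizationMonoid.pow_dvd_pow_iff_dvd two_ne_zero).1 h.symm.dvd)

theorem zmod_sq_cancel {p : ℕ} [Fact p.Prime] {x y : ZMod p} (hx : x ≠ 0) (h : IsSquare x)
    (h' : IsSquare (x * y)) : IsSquare y := by
  obtain ⟨s, rfl⟩ := h
  obtain ⟨t, ht⟩ := h'
  have hs : s ≠ 0 := by rintro rfl; simp at hx
  exact ⟨t / s, by field_simp; linear_combination ht⟩

section
variable {q₁ q₂ r δ δ' : ℕ} {F K : Type*} [Field F] [NumberField F] [Field K] [NumberField K]
    [Algebra F K] {a : F} {b : K}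

theorem Hyp.r_ndvd_d (H : Hyp q₁ q₂ r δ δ') : ¬ r ∣ q₁ * q₂ := by
  rw [H.hr.dvd_mul, Nat.prime_dvd_prime_iff_eq H.hr H.hq₁, Nat.prime_dvd_prime_iff_eq H.hr H.hq₂]
  have := H.hr1
  have := H.hr2
  tauto

theorem Hyp.r_ndvd_δ (H : Hyp q₁ q₂ r δ δ') : ¬ r ∣ 2 * δ := by
  have h2 : ¬ r ∣ 2 := by
    intro h
    have := Nat.le_of_dvd (by norm_num) h
    have := H.hr8
    omega
  rw [H.hr.dvd_mul, Nat.prime_dvd_prime_iff_eq H.hr H.pδ]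
  rcases H.hδ with ⟨rfl, rfl⟩ | ⟨rfl, rfl⟩
  · have := H.hr1
    tauto
  · have := H.hr2
    tauto

theorem exists_t (H : Hyp q₁ q₂ r δ δ') [Fact r.Prime] : ∃ t : ℚ_[r], t ^ 2 = q₁ * q₂ := by
  have := H.hr8
  obtain ⟨t, ht⟩ := pad_sqrt (p := r) (by omega) ((q₁ * q₂ : ℕ) : ℤ) (by
    rw [Int.natCast_dvd_natCast]; exact H.r_ndvd_d) (by push_cast; exact H.s1.mul H.s2)
  exact ⟨t, by rw [ht]; push_cast; ring⟩

theorem normD (H : Hyp q₁ q₂ r δ δ') [Fact r.Prime] : ‖(r * (2 * δ : ℕ) : ℚ_[r])‖ = (r : ℝ)⁻¹ :=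
  norm_pq _ H.r_ndvd_δ

/-- local obstruction at r, over F -/
theorem obsF (H : Hyp q₁ q₂ r δ δ') (D : FD q₁ q₂ r δ F K a b) (γ : K) (s : ℤ) (f : F)
    (hf : f ≠ 0) (hs : ¬ (r : ℤ) ∣ s) (h : Algebra.norm F γ = s * f ^ 2) :
    IsSquare (s : ZMod r) := by
  have : Fact r.Prime := ⟨H.hr⟩
  obtain ⟨t, ht⟩ := exists_t H
  obtain ⟨φ, hφ⟩ := quad_hom D.finF _ D.nsF a D.ha t (by rw [ht]; simp)
  obtain ⟨u, v, rfl⟩ := quad_repr D.finK _ D.nsK b D.hb γ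
  rw [quad_norm D.finK _ D.nsK b D.hb] at h
  have hf' : φ f ≠ 0 := by simpa using hf
  apply pad1 (r * (2 * δ : ℕ) : ℚ_[r]) (φ u / φ f) (φ v / φ f) (normD H) s hs
  have h' := congrArg φ h
  simp only [map_sub, map_mul, map_pow, map_ofNat, map_natCast, map_intCast] at h'
  push_cast
  field_simp
  linear_combination h'

theorem obsQ (H : Hyp q₁ q₂ r δ δ') (D : FD q₁ q₂ r δ F K a b) (γ : K) (s : ℤ) (m : ℚ)
    (hm : m ≠ 0) (hs : ¬ (r : ℤ) ∣ s) (h : Algebra.norm ℚ γ = s * m ^ 2) :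
    IsSquare (s : ZMod r) := by
  have : Fact r.Prime := ⟨H.hr⟩
  obtain ⟨t, ht⟩ := exists_t H
  obtain ⟨φ, hφ⟩ := quad_hom D.finF _ D.nsF a D.ha t (by rw [ht]; simp)
  obtain ⟨ψ, hψ⟩ := quad_hom D.finF _ D.nsF a D.ha (-t) (by rw [neg_sq, ht]; simp)
  obtain ⟨u, v, hγ⟩ := quad_repr D.finK _ D.nsK b D.hb γ
  have hN : Algebra.norm F γ = u ^ 2 - (2 * r * δ) * v ^ 2 := by
    rw [hγ, quad_norm D.finK _ D.nsK b D.hb]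
  rw [← Algebra.norm_norm (S := F)] at h
  obtain ⟨x, y, hν⟩ := quad_repr D.finF _ D.nsF a D.ha (Algebra.norm F γ)
  have hprod : φ (Algebra.norm F γ) * ψ (Algebra.norm F γ) = s * (m : ℚ_[r]) ^ 2 := by
    have h2 : Algebra.norm ℚ (Algebra.norm F γ) = x ^ 2 - (q₁ * q₂) * y ^ 2 := by
      rw [hν, quad_norm D.finF _ D.nsF a D.ha]
    rw [h] at h2
    have h3 := congrArg (fun z : ℚ => (z : ℚ_[r])) h2
    push_cast at h3
    rw [h3, hν]
    simp only [map_add, map_mul, hφ, hψ, eq_ratCast, map_ratCast]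
    linear_combination (-(y : ℚ_[r]) ^ 2) * ht
  have hm' : (m : ℚ_[r]) ≠ 0 := by exact_mod_cast hm
  apply pad1 (r * (2 * δ : ℕ) : ℚ_[r]) ((φ u * ψ u + (2 * r * δ) * φ v * ψ v) / m)
    ((φ u * ψ v + φ v * ψ u) / m) (normD H) s hs
  rw [hN] at hprod
  simp only [map_sub, map_mul, map_pow, map_ofNat, map_natCast] at hprod
  push_cast
  field_simp
  linear_combination hprod

theorem FD.exists_I2 (H : Hyp q₁ q₂ r δ δ') (D : FD q₁ q₂ r δ F K a b) :
    ∃ I : Ideal (𝓞 K), I ^ 2 = Ideal.span {2} := by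
  have hInt : IsIntegral ℤ b := by
    refine ⟨Polynomial.X ^ 2 - Polynomial.C ((2 * r * δ : ℕ) : ℤ), ?_, ?_⟩
    · monicity!
    · simp [D.hb']
  set x : 𝓞 K := ⟨b, hInt⟩ with hx
  have hxe : x ^ 2 = ((2 * r * δ : ℕ) : 𝓞 K) := by
    apply RingOfIntegers.coe_injective
    have : algebraMap (𝓞 K) K x = b := rfl
    rw [map_pow, this, D.hb', map_natCast]
    push_cast
    ring
  obtain ⟨m, hm⟩ : ∃ m : ℕ, r * δ = 2 * m + 1 := by
    have h1 : Odd r := by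
      have := H.hr8
      rw [Nat.odd_iff]; omega
    have h2 : Odd δ := by
      have h1 := H.hq₁8
      have h2 := H.hq₂8
      rw [Nat.odd_iff]
      rcases H.hδ with ⟨rfl, rfl⟩ | ⟨rfl, rfl⟩ <;> omega
    exact h1.mul h2
  rw [show 2 * r * δ = 2 * (r * δ) by ring, hm] at hxe
  push_cast at hxe
  refine ⟨Ideal.span {2, x}, ?_⟩
  rw [sq, Ideal.span_pair_mul_span_pair]
  apply le_antisymm
  · rw [Ideal.span_le]
    intro z hz
    simp only [Set.mem_insert_iff, Set.mem_singleton_iff] at hz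
    rw [SetLike.mem_coe, Ideal.mem_span_singleton]
    rcases hz with rfl | rfl | rfl | rfl
    · exact ⟨2, rfl⟩
    · exact ⟨x, rfl⟩
    · exact ⟨x, mul_comm _ _⟩
    · exact ⟨2 * m + 1, by rw [← hxe, sq]⟩
  · rw [Ideal.span_singleton_le_iff_mem]
    have e : (2 : 𝓞 K) = x * x - m * (2 * 2) := by rw [← sq, hxe]; ring
    have h2 : (2 : 𝓞 K) * 2 ∈ Ideal.span {(2 : 𝓞 K) * 2, 2 * x, x * 2, x * x} :=
      Ideal.subset_span (by simp)
    have h3 : x * x ∈ Ideal.span {(2 : 𝓞 K) * 2, 2 * x, x * 2, x * x} :=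
      Ideal.subset_span (by simp)
    have h4 := sub_mem h3 (Ideal.mul_mem_left _ (m : 𝓞 K) h2)
    rwa [← e] at h4

theorem relNorm_I2 (D : FD q₁ q₂ r δ F K a b) (I : Ideal (𝓞 K)) (hI : I ^ 2 = Ideal.span {2}) :
    Ideal.relNorm (𝓞 F) I = Ideal.span {2} := by
  apply sq_inj_ideal
  rw [← map_pow, hI, Ideal.relNorm_singleton, Ideal.span_singleton_pow]
  congr 2
  apply RingOfIntegers.coe_injective
  rw [Algebra.algebraMap_intNorm (K := F) (L := K)]
  have : algebraMap (𝓞 K) K 2 = algebraMap F K 2 := by simp only [map_ofNat]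
  rw [this, Algebra.norm_algebraMap, D.finK, map_pow, map_ofNat]

theorem absNorm_I2 (D : FD q₁ q₂ r δ F K a b) (I : Ideal (𝓞 K)) (hI : I ^ 2 = Ideal.span {2}) :
    Ideal.absNorm I = 4 := by
  have h4 : Module.finrank ℚ K = 4 := by
    rw [← Module.finrank_mul_finrank ℚ F K, D.finF, D.finK]
  have := congrArg Ideal.absNorm hI
  rw [map_pow, Ideal.absNorm_span_singleton] at this
  have e : Algebra.norm ℤ (2 : 𝓞 K) = 16 := by
    rw [show (2 : 𝓞 K) = algebraMap ℤ (𝓞 K) 2 by simp, Algebra.norm_algebraMap,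
      RingOfIntegers.rank, h4]; norm_num
  rw [e] at this
  have : Ideal.absNorm I ^ 2 = 4 ^ 2 := by rw [this]; norm_num
  exact Nat.pow_left_injective (n := 2) (by norm_num) this

open nonZeroDivisors in
theorem principal_of_square {R : Type*} [CommRing R] [IsDedekindDomain R] (I : (Ideal R)⁰)
    (h : IsSquare (ClassGroup.mk0 I)) :
    ∃ (J : Ideal R) (γ : R), γ ≠ 0 ∧ J ≠ ⊥ ∧ (I : Ideal R) * J ^ 2 = Ideal.span {γ} := by
  obtain ⟨y, hy⟩ := h
  obtain ⟨J, hJ⟩ := ClassGroup.mk0_surjective y⁻¹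
  have h1 : ClassGroup.mk0 (I * J ^ 2) = 1 := by
    rw [map_mul, map_pow, hJ, hy]
    generalize y = z
    group
  obtain ⟨J, hJm⟩ := J
  obtain ⟨I, hIm⟩ := I
  have hmem : I * J ^ 2 ∈ (Ideal R)⁰ := mul_mem hIm (pow_mem hJm 2)
  have e : (⟨I, hIm⟩ * ⟨J, hJm⟩ ^ 2 : (Ideal R)⁰) = ⟨I * J ^ 2, hmem⟩ := rfl
  rw [e] at h1
  obtain ⟨γ, hγ⟩ := ((ClassGroup.mk0_eq_one_iff hmem).1 h1).principal
  have hγ' : I * J ^ 2 = Ideal.span {γ} := hγ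
  refine ⟨J, γ, ?_, nonZeroDivisors.ne_zero hJm, hγ'⟩
  rintro rfl
  apply nonZeroDivisors.ne_zero hmem
  rw [hγ']; simp

theorem I2_not (H : Hyp q₁ q₂ r δ δ') (D : FD q₁ q₂ r δ F K a b) (I J : Ideal (𝓞 K))
    (hI : I ^ 2 = Ideal.span {2}) (γ : 𝓞 K) (hγ : γ ≠ 0) (h : I * J ^ 2 = Ideal.span {γ}) : False := by
  have h1 := congrArg (Ideal.relNorm (𝓞 F)) h
  rw [map_mul, map_pow, relNorm_I2 D I hI, Ideal.relNorm_singleton] at h1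
  have hd : (2 : 𝓞 F) ∣ Algebra.intNorm (𝓞 F) (𝓞 K) γ := by
    rw [← Ideal.mem_span_singleton]
    generalize Algebra.intNorm (𝓞 F) (𝓞 K) γ = w at h1
    generalize (Ideal.relNorm (𝓞 F)) J = J' at h1
    have h2 : w ∈ Ideal.span {w} := Ideal.mem_span_singleton_self _
    rw [← h1] at h2
    exact Ideal.mul_le_left (I := Ideal.span {(2 : 𝓞 F)}) (J := J' ^ 2) h2
  obtain ⟨y, hy⟩ := hd
  have hy0 : y ≠ 0 := by
    rintro rfl
    have : Algebra.intNorm (𝓞 F) (𝓞 K) γ ≠ 0 := by simpa using hγ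
    apply this; rw [hy]; simp
  rw [hy, ← Ideal.span_singleton_mul_span_singleton] at h1
  have h2 := mul_left_cancel₀ (by simp) h1
  have hsel : SelP F (algebraMap (𝓞 F) F y) :=
    ⟨1, y, _, one_ne_zero, hy0, h2.symm, by simp⟩
  obtain ⟨e, e', f, hf, hyf⟩ := stepB H D hsel
  have hN := congrArg (algebraMap (𝓞 F) F) hy
  rw [Algebra.algebraMap_intNorm (K := F) (L := K), map_mul, hyf, map_ofNat] at hN
  have : Fact r.Prime := ⟨H.hr⟩
  have hrz : Prime (r : ℤ) := Nat.prime_iff_prime_int.1 H.hr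
  have r1 := ndvd_neg_one H.hr
  have r2 : ¬ (r : ℤ) ∣ q₁ := by
    have := H.r_ndvd_d
    intro h
    exact this (Dvd.dvd.mul_right (by exact_mod_cast h) _)
  have r3 : ¬ (r : ℤ) ∣ 2 := by
    have := H.r_ndvd_δ
    intro h
    exact this (Dvd.dvd.mul_right (by exact_mod_cast h) _)
  have hs : ¬ (r : ℤ) ∣ ((if e then -1 else 1) * (if e' then (q₁ : ℤ) else 1)) := by
    intro h
    rcases hrz.dvd_or_dvd h with h | h
    · cases e <;> simp at h r1 <;> exact r1 h
    · cases e'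
      · simp at h r1; exact r1 h
      · simp at h; exact r2 h
  have := obsF H D (algebraMap (𝓞 K) K γ) (((if e then -1 else 1) * (if e' then (q₁ : ℤ) else 1)) * 2) f hf
    (by
      intro h
      rcases hrz.dvd_or_dvd h with h | h
      · exact hs h
      · exact r3 h) (by
      rw [hN]; push_cast; ring)
  push_cast at this
  apply H.two_r
  apply zmod_sq_cancel _ _ this
  · intro h
    apply hs
    rw [← ZMod.intCast_zmod_eq_zero_iff_dvd]
    push_cast
    simpa using h
  · apply IsSquare.mul
    · cases e
      · simp
      · simpa using H.neg_one_r
    · cases e'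
      · simp
      · simpa using H.s1

theorem norm_not (H : Hyp q₁ q₂ r δ δ') (D : FD q₁ q₂ r δ F K a b) (p m : ℕ) (hm : m ≠ 0)
    (hp : (p : ZMod r) = 2) (γ : 𝓞 K)
    (h : Ideal.absNorm (Ideal.span {γ}) = p * m ^ 2) : False := by
  have : Fact r.Prime := ⟨H.hr⟩
  rw [Ideal.absNorm_span_singleton] at h
  obtain ⟨e, he⟩ := int_par (Algebra.norm ℤ γ)
  rw [h] at he
  have h3 : (Algebra.norm ℤ γ : ℚ) = Algebra.norm ℚ (algebraMap (𝓞 K) K γ) := Algebra.coe_norm_int γ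
  rw [he] at h3
  have two0 : (2 : ZMod r) ≠ 0 := fun h => H.two_r (by rw [h]; exact IsSquare.zero)
  have hz : (((if e then -1 else 1) * (p : ℤ) : ℤ) : ZMod r) = (if e then -1 else 1) * 2 := by
    push_cast; rw [hp]
  have hsg : ((if e then -1 else 1) : ZMod r) ≠ 0 := by cases e <;> simp
  have := obsQ H D (algebraMap (𝓞 K) K γ) ((if e then -1 else 1) * p) m (by exact_mod_cast hm)
    (by
      rw [← ZMod.intCast_zmod_eq_zero_iff_dvd, hz]
      exact mul_ne_zero hsg two0) (by
      rw [← h3]; push_cast; ring)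
  rw [hz] at this
  apply H.two_r
  apply zmod_sq_cancel hsg _ this
  cases e
  · simp
  · simpa using H.neg_one_r

open nonZeroDivisors in
theorem lower_bound (H : Hyp q₁ q₂ r δ δ') (D : FD q₁ q₂ r δ F K a b) :
    4 ≤ Nat.card {x : ClassGroup (𝓞 K) // x ^ 2 = 1} := by
  obtain ⟨p, hp, hgt, hpr, s1, s2, s3⟩ := exists_p H
  have : Fact p.Prime := ⟨hp⟩
  obtain ⟨φ⟩ := exists_emb H D p hgt s1 s2 s3
  obtain ⟨P, hP⟩ := exists_ideal_norm K p φ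
  obtain ⟨I, hI⟩ := D.exists_I2 H
  have hI4 := absNorm_I2 D I hI
  have hI0 : I ∈ (Ideal (𝓞 K))⁰ := by
    rw [mem_nonZeroDivisors_iff_ne_zero]
    rintro rfl
    simp at hI4
  have hP0 : P ∈ (Ideal (𝓞 K))⁰ := by
    rw [mem_nonZeroDivisors_iff_ne_zero]
    rintro rfl
    simp at hP
    exact hp.ne_zero hP.symm
  have hJ0 : ∀ J : Ideal (𝓞 K), J ≠ ⊥ → Ideal.absNorm J ≠ 0 := by
    intro J hJ; rwa [Ne, Ideal.absNorm_eq_zero_iff]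
  apply group_four _ (ClassGroup.mk0 ⟨I, hI0⟩) (ClassGroup.mk0 ⟨P, hP0⟩)
  · intro h
    obtain ⟨J, γ, hγ, hJ, h⟩ := principal_of_square _ h
    exact I2_not H D I J hI γ hγ h
  · intro h
    obtain ⟨J, γ, hγ, hJ, h⟩ := principal_of_square _ h
    apply norm_not H D p (Ideal.absNorm J) (hJ0 J hJ) hpr γ
    rw [← h, map_mul, map_pow, hP]
  · rw [← map_mul]
    intro h
    obtain ⟨J, γ, hγ, hJ, h⟩ := principal_of_square _ h
    apply norm_not H D p (2 * Ideal.absNorm J) (mul_ne_zero two_ne_zero (hJ0 J hJ)) hpr γ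
    rw [← h, map_mul, map_pow]
    simp only [Submonoid.coe_mul, map_mul, hP, hI4]
    ring
end

theorem nat_ns8 (n : ℕ) (h : n % 8 = 5 ∨ n % 4 = 2) : ¬ IsSquare (n : ℚ) := by
  rw [Rat.isSquare_natCast_iff]
  rintro ⟨m, rfl⟩
  have h1 : m % 8 < 8 := Nat.mod_lt _ (by norm_num)
  have h2 : (m * m) % 8 = ((m % 8) * (m % 8)) % 8 := Nat.mul_mod _ _ _
  have h3 : (m * m) % 4 = ((m * m) % 8) % 4 := by omega
  rw [h3, h2] at h
  generalize m % 8 = k at h h1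
  interval_cases k <;> omega

section
variable {q₁ q₂ r δ δ' : ℕ}

theorem Hyp.nsF (H : Hyp q₁ q₂ r δ δ') : ¬ IsSquare ((q₁ * q₂ : ℚ)) := by
  have := nat_ns8 (q₁ * q₂) (Or.inl (by rw [Nat.mul_mod, H.hq₁8, H.hq₂8]))
  push_cast at this; exact this

theorem Hyp.odd_δ (H : Hyp q₁ q₂ r δ δ') : δ % 2 = 1 := by
  have := H.hq₁8
  have := H.hq₂8
  rcases H.hδ with ⟨rfl, rfl⟩ | ⟨rfl, rfl⟩ <;> omega

theorem two_odd {n : ℕ} (h : n % 2 = 1) : (2 * n) % 4 = 2 := by omega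

theorem Hyp.ns1 (H : Hyp q₁ q₂ r δ δ') : ¬ IsSquare ((2 * r * δ : ℚ)) := by
  have h1 := H.odd_δ
  have h2 : r % 2 = 1 := by have := H.hr8; omega
  have := nat_ns8 (2 * (r * δ)) (Or.inr (two_odd (by rw [Nat.mul_mod, h1, h2])))
  push_cast at this
  rwa [← mul_assoc] at this

theorem Hyp.ns2 (H : Hyp q₁ q₂ r δ δ') : ¬ IsSquare ((2 * r * δ * (q₁ * q₂) : ℚ)) := by
  have h1 := H.odd_δ
  have h2 : r % 2 = 1 := by have := H.hr8; omega
  have h3 : q₁ % 2 = 1 := by have := H.hq₁8; omega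
  have h4 : q₂ % 2 = 1 := by have := H.hq₂8; omega
  have := nat_ns8 (2 * (r * δ * (q₁ * q₂))) (Or.inr (two_odd (by simp [Nat.mul_mod, h1, h2, h3, h4])))
  push_cast at this
  simpa only [mul_assoc] using this

theorem nsK_of (H : Hyp q₁ q₂ r δ δ') {F : Type*} [Field F] [NumberField F]
    (finF : Module.finrank ℚ F = 2) (a : F) (ha : a ^ 2 = algebraMap ℚ F (q₁ * q₂)) :
    ¬ IsSquare ((2 * r * δ : F)) := by
  rintro ⟨y, hy⟩
  obtain ⟨u, v, rfl⟩ := quad_repr finF _ H.nsF a ha y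
  have e : algebraMap ℚ F (2 * u * v) * a = algebraMap ℚ F (2 * r * δ - u ^ 2 - q₁ * q₂ * v ^ 2) := by
    simp only [map_mul, map_sub, map_pow, map_natCast, map_ofNat] at ha ⊢
    rw [hy]
    linear_combination (-(algebraMap ℚ F v) ^ 2) * ha
  have huv : 2 * u * v = 0 := by
    by_contra h
    apply H.nsF
    refine ⟨(2 * r * δ - u ^ 2 - q₁ * q₂ * v ^ 2) / (2 * u * v), ?_⟩
    have h2 := congrArg (· ^ 2) e
    simp only [mul_pow, ha] at h2
    rw [← map_pow, ← map_mul, ← map_pow] at h2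
    have h3 := (algebraMap ℚ F).injective h2
    rw [div_mul_div_comm, eq_div_iff (mul_ne_zero h h)]
    linear_combination h3
  rw [huv, map_zero, zero_mul] at e
  have e' : 2 * r * δ - u ^ 2 - q₁ * q₂ * v ^ 2 = 0 := by
    apply (algebraMap ℚ F).injective
    rw [← e, map_zero]
  have : u = 0 ∨ v = 0 := by
    rcases mul_eq_zero.1 huv with h | h
    · left; linarith
    · right; exact h
  rcases this with rfl | rfl
  · apply H.ns2
    exact ⟨q₁ * q₂ * v, by linear_combination (q₁ * q₂ : ℚ) * e'⟩
  · apply H.ns1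
    exact ⟨u, by linear_combination e'⟩

open Polynomial in
theorem finrank_adjoin_sq {k L : Type*} [Field k] [Field L] [Algebra k L] (c : k)
    (hc : ¬ IsSquare c) (x : L) (hx : x ^ 2 = algebraMap k L c) :
    Module.finrank k (IntermediateField.adjoin k {x}) = 2 := by
  have hm : (X ^ 2 - C c : k[X]).Monic := monic_X_pow_sub_C c two_ne_zero
  have hirr : Irreducible (X ^ 2 - C c : k[X]) := by
    apply X_pow_sub_C_irreducible_of_prime Nat.prime_two
    intro b hb
    exact hc ⟨b, by rw [← hb, sq]⟩
  have h0 : aeval x (X ^ 2 - C c : k[X]) = 0 := by simp [hx]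
  have hi : IsIntegral k x := ⟨_, hm, h0⟩
  rw [IntermediateField.adjoin.finrank hi, ← minpoly.eq_of_irreducible_of_monic hirr h0 hm,
    natDegree_X_pow_sub_C]

theorem real_of_sq (z : ℂ) (c : ℚ) (hc : 0 < c) (h : z ^ 2 = c) : (starRingEnd ℂ) z = z := by
  rw [Complex.conj_eq_iff_im]
  have h1 := congrArg Complex.re h
  have h2 := congrArg Complex.im h
  simp [sq] at h1 h2
  have hc' : (0 : ℝ) < c := by exact_mod_cast hc
  have h3 : z.re = 0 ∨ z.im = 0 := by
    rw [← mul_eq_zero]; linarith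
  rcases h3 with h3 | h3
  · rw [h3] at h1; nlinarith
  · exact h3

theorem units_rank_three (H : Hyp q₁ q₂ r δ δ') {F K : Type*} [Field F] [NumberField F] [Field K]
    [NumberField K] [Algebra F K] {a : F} {b : K} (D : FD q₁ q₂ r δ F K a b) :
    Units.rank K = 3 := by
  have htr : IsTotallyReal K := by
    constructor
    intro v
    rw [← InfinitePlace.mk_embedding v, InfinitePlace.isReal_mk_iff]
    generalize v.embedding = φ
    have p1 : (0 : ℚ) < q₁ * q₂ := by
      have := H.hq₁.pos
      have := H.hq₂.pos
      positivity
    have p2 : (0 : ℚ) < 2 * r * δ := by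
      have := H.hr.pos
      have : 0 < δ := by have := H.odd_δ; omega
      positivity
    have ha : φ (algebraMap F K a) ^ 2 = ((q₁ * q₂ : ℚ) : ℂ) := by
      rw [← map_pow, ← map_pow, D.ha]; simp
    have hb : φ b ^ 2 = ((2 * r * δ : ℚ) : ℂ) := by
      rw [← map_pow, D.hb]; simp [map_ofNat]
    have ha' := real_of_sq _ _ p1 ha
    have hb' := real_of_sq _ _ p2 hb
    have hF : ∀ u : F, (starRingEnd ℂ) (φ (algebraMap F K u)) = φ (algebraMap F K u) := by
      intro u
      obtain ⟨s, t, rfl⟩ := quad_repr D.finF _ D.nsF a D.ha u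
      simp [ha']
    rw [ComplexEmbedding.isReal_iff]
    ext y
    obtain ⟨s, t, rfl⟩ := quad_repr D.finK _ D.nsK b D.hb y
    simp [hb', hF]
  have h4 : Module.finrank ℚ K = 4 := by
    rw [← Module.finrank_mul_finrank ℚ F K, D.finF, D.finK]
  have h5 := IsTotallyReal.finrank (K := K)
  have h6 := InfinitePlace.card_eq_nrRealPlaces_add_nrComplexPlaces (K := K)
  rw [IsTotallyReal.nrComplexPlaces_eq_zero] at h6
  unfold Units.rank
  omega

theorem card_four (H : Hyp q₁ q₂ r δ δ') {K : Type*} [Field K] [NumberField K]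
    (a b : K) (ha : a ^ 2 = algebraMap ℚ K (q₁ * q₂)) (hb : b ^ 2 = algebraMap ℚ K (2 * r * δ))
    (hneg : ∀ k : K, k ^ 2 ≠ -1) (ht : ∀ S : Subfield K, a ∈ S → b ∈ S → ∀ z, z ∈ S) :
    Nat.card {x : ClassGroup (𝓞 K) // x ^ 2 = 1} = 4 := by
  have htop : IntermediateField.adjoin ℚ {a, b} = ⊤ := by
    rw [eq_top_iff]
    intro z _
    exact ht (IntermediateField.adjoin ℚ {a, b}).toSubfield
      (IntermediateField.subset_adjoin ℚ _ (by simp))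
      (IntermediateField.subset_adjoin ℚ _ (by simp)) z
  have finF := finrank_adjoin_sq _ H.nsF a ha
  let F := IntermediateField.adjoin ℚ {a}
  let a' : F := ⟨a, IntermediateField.mem_adjoin_simple_self ℚ a⟩
  have ha' : a' ^ 2 = algebraMap ℚ F (q₁ * q₂) := by
    apply Subtype.ext
    exact ha
  have nsK := nsK_of H finF a' ha'
  have hb' : b ^ 2 = algebraMap F K (2 * r * δ) := by
    rw [hb]; simp only [map_mul, map_natCast, map_ofNat]
  have finK : Module.finrank F K = 2 := by
    have h1 := finrank_adjoin_sq _ nsK b hb'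
    have h2 : IntermediateField.adjoin F {b} = ⊤ := by
      rw [← IntermediateField.restrictScalars_eq_top_iff (K := ℚ)]
      refine (IntermediateField.adjoin_adjoin_left ℚ {a} {b}).trans ?_
      rw [← htop]
      rfl
    rw [h2] at h1
    rwa [IntermediateField.finrank_top'] at h1
  have D : FD q₁ q₂ r δ F K a' b := ⟨finF, finK, ha', hb', H.nsF, nsK⟩
  exact le_antisymm (upper_bound K hneg (units_rank_three H D) (selmer_bound H D)) (lower_bound H D)

end

/-- Let q₁ ≡ 7 (mod 8) and q₂ ≡ 3 (mod 8) be primes and r a prime with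
r ≡ 5 (mod 8), (q₁q₂/r) = 1 and (q₁/r) = 1. Then the 2-class group of
K = Q(√(q₁q₂), √(2rδ)) with δ ∈ {1, q₁, q₂} chosen so that δr ≡ 3 (mod 4), has rank
exactly 2. -/
theorem stmt13 (q₁ q₂ r δ : ℕ) (hq₁ : q₁.Prime) (hq₂ : q₂.Prime) (hr : r.Prime)
    (hq₁q₂ : q₁ ≠ q₂) (hrq₁ : r ≠ q₁) (hrq₂ : r ≠ q₂)
    (hq₁8 : q₁ % 8 = 7) (hq₂8 : q₂ % 8 = 3) (hr8 : r % 8 = 5)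
    (hleg₁ : @legendreSym r ⟨hr⟩ ((q₁ : ℤ) * q₂) = 1)
    (hleg₂ : @legendreSym r ⟨hr⟩ (q₁ : ℤ) = 1)
    (hδ : δ = 1 ∨ δ = q₁ ∨ δ = q₂) (hδr : (δ * r) % 4 = 3) :
    twoRank (ClassGroup
      (𝓞 (Qadj {Real.sqrt (q₁ * q₂), Real.sqrt (2 * (δ * r))}))) = 2 := by
  have : Fact r.Prime := ⟨hr⟩
  have hl1 := (legendreSym.eq_one_iff r (a := (q₁ : ℤ)) (by
    intro h
    rw [(legendreSym.eq_zero_iff r _).2 h] at hleg₂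
    exact zero_ne_one hleg₂)).1 hleg₂
  have hleg₃ : legendreSym r (q₂ : ℤ) = 1 := by
    have := legendreSym.mul r (q₁ : ℤ) q₂
    rw [hleg₁, hleg₂, one_mul] at this
    exact this.symm
  have hl2 := (legendreSym.eq_one_iff r (a := (q₂ : ℤ)) (by
    intro h
    rw [(legendreSym.eq_zero_iff r _).2 h] at hleg₃
    exact zero_ne_one hleg₃)).1 hleg₃
  have hδ' : ∃ δ', (δ = q₁ ∧ δ' = q₂) ∨ (δ = q₂ ∧ δ' = q₁) := by
    rcases hδ with rfl | rfl | rfl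
    · omega
    · exact ⟨q₂, Or.inl ⟨rfl, rfl⟩⟩
    · exact ⟨q₁, Or.inr ⟨rfl, rfl⟩⟩
  obtain ⟨δ', hδ'⟩ := hδ'
  have H : Hyp q₁ q₂ r δ δ' := ⟨hq₁, hq₂, hr, hq₁q₂, hrq₁, hrq₂, hq₁8, hq₂8, hr8,
    by simpa using hl1, by simpa using hl2, hδ'⟩
  have hsa : Real.sqrt (q₁ * q₂) ^ 2 = q₁ * q₂ := Real.sq_sqrt (by positivity)
  have hsb : Real.sqrt (2 * (δ * r)) ^ 2 = 2 * (δ * r) := Real.sq_sqrt (by positivity)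
  generalize Real.sqrt (q₁ * q₂) = x at hsa
  generalize Real.sqrt (2 * (δ * r)) = y at hsb
  have ix : IsIntegral ℚ x := by
    apply IsIntegral.of_pow (n := 2) (by norm_num)
    rw [hsa]
    exact_mod_cast (isIntegral_algebraMap (R := ℚ) (A := ℝ) (x := ((q₁ * q₂ : ℕ) : ℚ)))
  have iy : IsIntegral ℚ y := by
    apply IsIntegral.of_pow (n := 2) (by norm_num)
    rw [hsb]
    exact_mod_cast (isIntegral_algebraMap (R := ℚ) (A := ℝ) (x := ((2 * (δ * r) : ℕ) : ℚ)))
  have hfin : FiniteDimensional ℚ (Qadj {x, y}) := by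
    unfold Qadj
    have : Finite ({x, y} : Set ℝ) := Set.toFinite _
    apply IntermediateField.finiteDimensional_adjoin
    rintro z (rfl | rfl)
    · exact ix
    · exact iy
  have : NumberField (Qadj {x, y}) := { to_charZero := inferInstance, to_finiteDimensional := hfin }
  have hx : x ∈ Qadj {x, y} := IntermediateField.subset_adjoin ℚ _ (by simp)
  have hy : y ∈ Qadj {x, y} := IntermediateField.subset_adjoin ℚ _ (by simp)
  have key := card_four H (K := Qadj {x, y}) ⟨x, hx⟩ ⟨y, hy⟩
    (by apply Subtype.ext; simpa using hsa)
    (by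
      apply Subtype.ext
      have : (2 * (δ * r) : ℝ) = 2 * r * δ := by ring
      rw [this] at hsb
      simp only [map_mul, map_natCast, map_ofNat]
      exact hsb)
    (by
      intro k hk
      have h1 : (k : ℝ) ^ 2 = -1 := by
        have := congrArg (Subtype.val) hk
        simpa using this
      nlinarith [sq_nonneg (k : ℝ)])
    (by
      rintro S hxS hyS ⟨z, hz⟩
      induction hz using IntermediateField.adjoin_induction with
      | mem w hw =>
        rcases hw with rfl | rfl
        · exact hxS
        · exact hyS
      | algebraMap q =>
        exact SubfieldClass.ratCast_mem S q
      | add u v hu hv h1 h2 => exact add_mem h1 h2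
      | inv u hu h1 => exact inv_mem h1
      | mul u v hu hv h1 h2 => exact mul_mem h1 h2)
  unfold twoRank
  rw [key]
  decide
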